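/- arXiv:1902.01063 — 2 statements merged into one kernel-verified Lean document; each statement's English description precedes it below -/
import Mathlib

section
/- Let p > 2. Then for every 2π-periodic C¹ function u : ℝ → ℝ that is not identically zero, setting E := (2/p) · (1/(2π))∫₀^{2π} (|u(x)|^p/‖u‖_p^p) · log(|u(x)|/‖u‖_p) dx (integrand interpreted as 0 where u vanishes) and a := ((p−1)²/(2p(2p−1))) · λ₁^{p−2}, one has ‖u'‖_p² ≥ λ₁ · ‖u‖_p² · (E + a·E^p). (Improved L^p logarithmic Sobolev inequality, Theorem 3.1 with q = p.) -/
open MeasureTheory Real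

/-- The L^r norm on the circle with the uniform probability measure dσ = dx/(2π),
for a 2π-periodic function `u : ℝ → ℝ`. -/
noncomputable def perNorm (r : ℝ) (u : ℝ → ℝ) : ℝ :=
  ((1 / (2 * π)) * ∫ x in (0:ℝ)..(2 * π), |u x| ^ r) ^ (1 / r)

/-- `u` is 2π-periodic and C¹. -/
def PeriodicC1 (u : ℝ → ℝ) : Prop :=
  Function.Periodic u (2 * π) ∧ ContDiff ℝ 1 u

/-- λ₁ = inf ‖v'‖_p²/‖v‖_p² over 2π-periodic C¹ functions v ≢ 0 with ∫₀^{2π} v dx = 0. -/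
noncomputable def lambdaOne (p : ℝ) : ℝ :=
  sInf { l : ℝ | ∃ v : ℝ → ℝ, PeriodicC1 v ∧ v ≠ 0 ∧
    (∫ x in (0:ℝ)..(2 * π), v x) = 0 ∧
    l = (perNorm p (deriv v)) ^ 2 / (perNorm p v) ^ 2 }

/-- λ₁* = inf ‖v'‖_p²/‖v‖_2² over 2π-periodic C¹ functions v ≢ 0 with ∫₀^{2π} v dx = 0. -/
noncomputable def lambdaOneStar (p : ℝ) : ℝ :=
  sInf { l : ℝ | ∃ v : ℝ → ℝ, PeriodicC1 v ∧ v ≠ 0 ∧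
    (∫ x in (0:ℝ)..(2 * π), v x) = 0 ∧
    l = (perNorm p (deriv v)) ^ 2 / (perNorm 2 v) ^ 2 }

/-- The p-Laplacian L_p u = (|u'|^{p-2} u')'. -/
noncomputable def pLap (p : ℝ) (u : ℝ → ℝ) : ℝ → ℝ :=
  deriv (fun x => |deriv u x| ^ (p - 2) * deriv u x)


lemma wirtinger_aux (g g' : ℝ → ℝ) (hg : ∀ x, HasDerivAt g (g' x) x) (hc : Continuous g')
    (hper : g (2 * π) = g 0) (hmean : ∫ x in (0:ℝ)..(2 * π), g x = 0) :
    ∫ x in (0:ℝ)..(2 * π), g x ^ 2 ≤ ∫ x in (0:ℝ)..(2 * π), g' x ^ 2 := by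
  have hab : (0:ℝ) < 2 * π := by positivity
  have hgc : Continuous g := continuous_iff_continuousAt.2 fun x => (hg x).continuousAt
  have mem : ∀ h : ℝ → ℝ, Continuous h →
      MemLp (fun x => (h x : ℂ)) 2 (volume.restrict (Set.Ioc 0 (2 * π))) := by
    intro h hh
    have h1 : Continuous (fun x => (h x : ℂ)) := by fun_prop
    obtain ⟨K, hK⟩ := (isCompact_Icc (a := (0:ℝ)) (b := 2 * π)).exists_bound_of_continuousOn
      h1.continuousOn
    refine MemLp.of_bound h1.aestronglyMeasurable K ?_
    filter_upwards [ae_restrict_mem measurableSet_Ioc] with x hx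
    exact hK x ⟨hx.1.le, hx.2⟩
  have s1 := hasSum_sq_fourierCoeffOn hab (mem g hgc)
  have s2 := hasSum_sq_fourierCoeffOn hab (mem g' hc)
  have key : ∀ n : ℤ, ‖fourierCoeffOn hab (fun x => (g x : ℂ)) n‖ ^ 2
      ≤ ‖fourierCoeffOn hab (fun x => (g' x : ℂ)) n‖ ^ 2 := by
    intro n
    by_cases hn : n = 0
    · subst hn
      have : fourierCoeffOn hab (fun x => (g x : ℂ)) 0 = 0 := by
        rw [fourierCoeffOn_eq_integral]
        simp only [neg_zero, fourier_zero, one_smul]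
        rw [intervalIntegral.integral_ofReal, hmean]
        simp
      rw [this]; simp
    · have h := fourierCoeffOn_of_hasDerivAt hab (f := fun x => (g x : ℂ))
        (f' := fun x => (g' x : ℂ)) hn (fun x _ => (hg x).ofReal_comp)
        (by apply Continuous.intervalIntegrable; fun_prop)
      rw [h]
      simp only [hper, sub_self, mul_zero, zero_sub]
      have hn1 : (1:ℝ) ≤ |(n:ℝ)| := by
        exact_mod_cast Int.one_le_abs hn
      gcongr
      rw [norm_mul, norm_neg, norm_mul]
      simp only [norm_div, norm_mul, norm_neg, norm_one, Complex.norm_I, Complex.norm_intCast]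
      have hpi : ‖(π:ℂ)‖ = π := by simp [abs_of_pos pi_pos]
      have e2 : ‖((2 * π : ℝ) : ℂ) - ((0:ℝ):ℂ)‖ = 2 * π := by
        rw [← Complex.ofReal_sub, Complex.norm_real]; simp [abs_of_pos pi_pos]
      rw [e2, hpi]
      have : ‖(2:ℂ)‖ = 2 := by simp
      rw [this]
      set c := ‖fourierCoeffOn hab (fun x => (g' x : ℂ)) n‖
      have hc0 : 0 ≤ c := norm_nonneg _
      have : 1 / (2 * π * 1 * |(n:ℝ)|) * (2 * π * c) = c / |(n:ℝ)| := by
        field_simp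
      rw [this]
      exact div_le_self hc0 hn1
  have := hasSum_le key s1 s2
  simp only [Complex.norm_real, norm_eq_abs, sq_abs, sub_zero, smul_eq_mul] at this
  exact le_of_mul_le_mul_left this (by positivity)

lemma core_aux (r r1 r2 r3 : ℝ → ℝ) (h0 : ∀ x, HasDerivAt r (r1 x) x)
    (h1 : ∀ x, HasDerivAt r1 (r2 x) x) (h2 : ∀ x, HasDerivAt r2 (r3 x) x) (c3 : Continuous r3)
    (pos : ∀ x, 0 < r x) (p0 : r (2 * π) = r 0) (p1 : r1 (2 * π) = r1 0)
    (p2 : r2 (2 * π) = r2 0) :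
    ∫ x in (0:ℝ)..(2 * π), (2 * r1 x * r3 x / r x - r1 x ^ 2 * r2 x / r x ^ 2) ≤
      -2 * ((∫ x in (0:ℝ)..(2 * π), r1 x ^ 2 / r x) +
        (∫ x in (0:ℝ)..(2 * π), r1 x ^ 2 / r x) ^ 2 / (12 * ∫ x in (0:ℝ)..(2 * π), r x)) := by
  have hab : (0:ℝ) < 2 * π := by positivity
  have c0 : Continuous r := continuous_iff_continuousAt.2 fun x => (h0 x).continuousAt
  have c1 : Continuous r1 := continuous_iff_continuousAt.2 fun x => (h1 x).continuousAt
  have c2 : Continuous r2 := continuous_iff_continuousAt.2 fun x => (h2 x).continuousAt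
  have ne : ∀ x, r x ≠ 0 := fun x => (pos x).ne'
  have ii : ∀ f : ℝ → ℝ, Continuous f → IntervalIntegrable f volume 0 (2 * π) :=
    fun f hf => hf.intervalIntegrable _ _
  set I := ∫ x in (0:ℝ)..(2 * π), r1 x ^ 2 / r x with hI
  set M := ∫ x in (0:ℝ)..(2 * π), r x with hM
  have hMpos : 0 < M := intervalIntegral.intervalIntegral_pos_of_pos (ii _ c0) pos hab
  set A := ∫ x in (0:ℝ)..(2 * π), r2 x ^ 2 / r x with hA
  set B := ∫ x in (0:ℝ)..(2 * π), r1 x ^ 4 / r x ^ 3 with hB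
  set C := ∫ x in (0:ℝ)..(2 * π), r1 x ^ 2 * r2 x / r x ^ 2 with hC
  set D := ∫ x in (0:ℝ)..(2 * π), r1 x * r3 x / r x with hD
  have cI : Continuous fun x => r1 x ^ 2 / r x := by fun_prop (disch := assumption)
  have cA : Continuous fun x => r2 x ^ 2 / r x := by fun_prop (disch := assumption)
  have cB : Continuous fun x => r1 x ^ 4 / r x ^ 3 :=
    (c1.pow 4).div₀ (c0.pow 3) fun x => pow_ne_zero _ (ne x)
  have cC : Continuous fun x => r1 x ^ 2 * r2 x / r x ^ 2 :=
    ((c1.pow 2).mul c2).div₀ (c0.pow 2) fun x => pow_ne_zero _ (ne x)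
  have cD : Continuous fun x => r1 x * r3 x / r x := by fun_prop (disch := assumption)
  -- integration by parts 1
  have e1 : A + D - C = 0 := by
    have hd : ∀ x, HasDerivAt (fun x => r1 x * r2 x / r x)
        (r2 x ^ 2 / r x + r1 x * r3 x / r x - r1 x ^ 2 * r2 x / r x ^ 2) x := by
      intro x
      refine (((h1 x).fun_mul (h2 x)).fun_div (h0 x) (ne x)).congr_deriv ?_
      have := ne x
      field_simp
    have := intervalIntegral.integral_eq_sub_of_hasDerivAt (a := 0) (b := 2 * π)
      (fun x _ => hd x) (ii _ ((cA.fun_add cD).sub cC))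
    rw [intervalIntegral.integral_sub (ii _ (cA.fun_add cD)) (ii _ cC),
      intervalIntegral.integral_add (ii _ cA) (ii _ cD)] at this
    rw [hA, hD, hC, this, p0, p1, p2, sub_self]
  have e2 : 3 * C - 2 * B = 0 := by
    have hd : ∀ x, HasDerivAt (fun x => r1 x ^ 3 / r x ^ 2)
        (3 * (r1 x ^ 2 * r2 x / r x ^ 2) - 2 * (r1 x ^ 4 / r x ^ 3)) x := by
      intro x
      refine (((h1 x).fun_pow 3).fun_div ((h0 x).fun_pow 2) (pow_ne_zero _ (ne x))).congr_deriv ?_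
      have := ne x
      field_simp
      push_cast
      ring
    have := intervalIntegral.integral_eq_sub_of_hasDerivAt (a := 0) (b := 2 * π)
      (fun x _ => hd x) (ii _ ((cC.const_mul 3).sub (cB.const_mul 2)))
    rw [intervalIntegral.integral_sub (ii _ (cC.const_mul 3)) (ii _ (cB.const_mul 2)),
      intervalIntegral.integral_const_mul, intervalIntegral.integral_const_mul] at this
    rw [hB, hC, this, p0, p1, sub_self]
  -- Wirtinger
  have e3 : I / 4 ≤ A / 4 - C / 4 + B / 16 := by
    have hs : ∀ x, 0 < √(r x) := fun x => Real.sqrt_pos.2 (pos x)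
    have hsd : ∀ x, HasDerivAt (fun x => √(r x)) (r1 x / (2 * √(r x))) x := fun x =>
      (h0 x).sqrt (ne x)
    have hgd : ∀ x, HasDerivAt (fun x => r1 x / (2 * √(r x)))
        ((r2 x - r1 x ^ 2 / (2 * r x)) / (2 * √(r x))) x := by
      intro x
      refine ((h1 x).fun_div ((hsd x).const_mul 2) (by have := hs x; positivity)).congr_deriv ?_
      have h5 := hs x
      have h6 := ne x
      have h7 : √(r x) ^ 2 = r x := Real.sq_sqrt (pos x).le
      field_simp
      rw [h7]
      ring
    have hns : ∀ x, 2 * √(r x) ≠ 0 := fun x => by have := hs x; positivity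
    have hnr : ∀ x, 2 * r x ≠ 0 := fun x => by have := pos x; positivity
    have cg : Continuous fun x => r1 x / (2 * √(r x)) :=
      continuous_iff_continuousAt.2 fun x => (hgd x).continuousAt
    have cg' : Continuous fun x => (r2 x - r1 x ^ 2 / (2 * r x)) / (2 * √(r x)) := by
      fun_prop (disch := assumption)
    have w := wirtinger_aux _ _ hgd cg' (by rw [p0, p1]) (by
      rw [intervalIntegral.integral_eq_sub_of_hasDerivAt (fun x _ => hsd x) (ii _ cg), p0, sub_self])
    have f1 : ∀ x, (r1 x / (2 * √(r x))) ^ 2 = (1 / 4) * (r1 x ^ 2 / r x) := by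
      intro x
      have h7 : √(r x) ^ 2 = r x := Real.sq_sqrt (pos x).le
      rw [div_pow, mul_pow, h7]; have := ne x; field_simp; norm_num
    have f2 : ∀ x, ((r2 x - r1 x ^ 2 / (2 * r x)) / (2 * √(r x))) ^ 2 =
        (1 / 4) * (r2 x ^ 2 / r x) - (1 / 4) * (r1 x ^ 2 * r2 x / r x ^ 2)
          + (1 / 16) * (r1 x ^ 4 / r x ^ 3) := by
      intro x
      have h7 : √(r x) ^ 2 = r x := Real.sq_sqrt (pos x).le
      rw [div_pow, mul_pow, h7]; have := ne x; field_simp; ring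
    simp only [f1, f2] at w
    rw [intervalIntegral.integral_add (ii _ ((cA.const_mul _).fun_sub (cC.const_mul _)))
        (ii _ (cB.const_mul _)),
      intervalIntegral.integral_sub (ii _ (cA.const_mul _)) (ii _ (cC.const_mul _)),
      intervalIntegral.integral_const_mul, intervalIntegral.integral_const_mul,
      intervalIntegral.integral_const_mul, intervalIntegral.integral_const_mul] at w
    linarith
  have e4 : I ^ 2 / M ≤ B := by
    have hn : 0 ≤ ∫ x in (0:ℝ)..(2 * π), (r1 x ^ 4 / r x ^ 3 - (2 * (I / M)) * (r1 x ^ 2 / r x)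
        + (I / M) ^ 2 * r x) := by
      apply intervalIntegral.integral_nonneg hab.le
      intro x _
      have : r1 x ^ 4 / r x ^ 3 - (2 * (I / M)) * (r1 x ^ 2 / r x) + (I / M) ^ 2 * r x
          = r x * (r1 x ^ 2 / r x ^ 2 - I / M) ^ 2 := by
        have := ne x
        field_simp
        ring
      rw [this]
      have := pos x
      positivity
    rw [intervalIntegral.integral_add (ii _ (cB.fun_sub (cI.const_mul _))) (ii _ (c0.const_mul _)),
      intervalIntegral.integral_sub (ii _ cB) (ii _ (cI.const_mul _)),
      intervalIntegral.integral_const_mul, intervalIntegral.integral_const_mul] at hn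
    rw [← hB, ← hI, ← hM] at hn
    have : B - 2 * (I / M) * I + (I / M) ^ 2 * M = B - I ^ 2 / M := by
      field_simp; ring
    linarith
  have e5 : ∫ x in (0:ℝ)..(2 * π), (2 * r1 x * r3 x / r x - r1 x ^ 2 * r2 x / r x ^ 2)
      = 2 * D - C := by
    rw [hD, hC, ← intervalIntegral.integral_const_mul, ← intervalIntegral.integral_sub
      (ii _ (cD.const_mul _)) (ii _ cC)]
    congr 1; ext x; ring
  rw [e5]
  have e6 : I ^ 2 / (12 * M) = I ^ 2 / M / 12 := by field_simp
  rw [e6]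
  linarith

noncomputable def heatT (s : Finset ℤ) (a b : ℤ → ℝ) (t x : ℝ) : ℝ :=
  ∑ k ∈ s, exp (-(k:ℝ) ^ 2 * t) * (a k * cos (k * x) + b k * sin (k * x))

lemma heatT_dx (s : Finset ℤ) (a b : ℤ → ℝ) (t x : ℝ) :
    HasDerivAt (fun x => heatT s a b t x)
      (heatT s (fun k => k * b k) (fun k => -(k * a k)) t x) x := by
  unfold heatT
  refine HasDerivAt.fun_sum fun k _ => ?_
  have h : HasDerivAt (fun x : ℝ => (k:ℝ) * x) k x := by
    simpa using (hasDerivAt_id x).const_mul (k:ℝ)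
  refine (((h.cos.const_mul (a k)).fun_add (h.sin.const_mul (b k))).const_mul _).congr_deriv ?_
  ring

lemma heatT_dt (s : Finset ℤ) (a b : ℤ → ℝ) (t x : ℝ) :
    HasDerivAt (fun t => heatT s a b t x)
      (heatT s (fun k => k * -(k * a k)) (fun k => -(k * (k * b k))) t x) t := by
  unfold heatT
  refine HasDerivAt.fun_sum fun k _ => ?_
  have h : HasDerivAt (fun t : ℝ => -(k:ℝ) ^ 2 * t) (-(k:ℝ) ^ 2) t := by
    simpa using (hasDerivAt_id t).const_mul (-(k:ℝ) ^ 2)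
  refine (h.exp.mul_const _).congr_deriv ?_
  ring

lemma heatT_cont (s : Finset ℤ) (a b : ℤ → ℝ) :
    Continuous (fun z : ℝ × ℝ => heatT s a b z.1 z.2) := by
  unfold heatT
  fun_prop

lemma heatT_per (s : Finset ℤ) (a b : ℤ → ℝ) (t x : ℝ) :
    heatT s a b t (x + 2 * π) = heatT s a b t x := by
  unfold heatT
  refine Finset.sum_congr rfl fun k _ => ?_
  have : (k:ℝ) * (x + 2 * π) = k * x + k * (2 * π) := by ring
  rw [this, cos_add_int_mul_two_pi, sin_add_int_mul_two_pi]

lemma heatT_bound (s : Finset ℤ) (a b : ℤ → ℝ) : ∃ K, ∀ t x, 0 ≤ t → |heatT s a b t x| ≤ K := by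
  refine ⟨∑ k ∈ s, (|a k| + |b k|), fun t x ht => ?_⟩
  unfold heatT
  refine (Finset.abs_sum_le_sum_abs _ _).trans (Finset.sum_le_sum fun k _ => ?_)
  rw [abs_mul, abs_of_pos (exp_pos _)]
  have h1 : exp (-(k:ℝ) ^ 2 * t) ≤ 1 := by
    rw [exp_le_one_iff]; have := mul_nonneg (sq_nonneg (k:ℝ)) ht; linarith
  have h2 : |a k * cos (k * x) + b k * sin (k * x)| ≤ |a k| + |b k| := by
    refine (abs_add_le _ _).trans ?_
    rw [abs_mul, abs_mul]
    have := abs_cos_le_one (k * x)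
    have := abs_sin_le_one (k * x)
    have := abs_nonneg (a k)
    have := abs_nonneg (b k)
    nlinarith
  calc _ ≤ 1 * (|a k| + |b k|) := by gcongr
    _ = _ := one_mul _

lemma heatT_tendsto (s : Finset ℤ) (h0 : (0:ℤ) ∉ s) (a b : ℤ → ℝ) (x : ℝ) :
    Filter.Tendsto (fun t => heatT s a b t x) Filter.atTop (nhds 0) := by
  unfold heatT
  rw [← Finset.sum_const_zero (s := s)]
  refine tendsto_finsetSum _ fun k hk => ?_
  have hk0 : k ≠ 0 := fun h => h0 (h ▸ hk)
  have hk1 : (0:ℝ) < (k:ℝ) ^ 2 := by positivity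
  rw [← zero_mul (a k * cos (k * x) + b k * sin (k * x))]
  refine Filter.Tendsto.mul_const _ ?_
  exact tendsto_exp_atBot.comp
    (Filter.Tendsto.const_mul_atTop_of_neg (by linarith) Filter.tendsto_id)

open ProbabilityTheory in
lemma heatT_gauss (s : Finset ℤ) (a b : ℤ → ℝ) (t : NNReal) (x : ℝ) :
    heatT s a b t x = ∫ z, heatT s a b 0 z ∂(gaussianReal x (2 * t)) := by
  have key : ∀ k : ℤ, ((∫ z, cos (k * z) ∂(gaussianReal x (2 * t))) = exp (-(k:ℝ) ^ 2 * t) * cos (k * x))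
      ∧ ((∫ z, sin (k * z) ∂(gaussianReal x (2 * t))) = exp (-(k:ℝ) ^ 2 * t) * sin (k * x)) := by
    intro k
    have h := charFun_gaussianReal (μ := x) (v := 2 * t) (k:ℝ)
    rw [charFun_apply_real] at h
    have hint : Integrable (fun z : ℝ => Complex.exp ((k:ℝ) * z * Complex.I)) (gaussianReal x (2 * t)) := by
      refine Integrable.of_bound (C := 1) (Continuous.aestronglyMeasurable (by fun_prop)) ?_
      refine Filter.Eventually.of_forall fun z => ?_
      rw [← Complex.ofReal_mul, Complex.norm_exp_ofReal_mul_I]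
    have hre : ∀ z : ℝ, (Complex.exp ((k:ℝ) * z * Complex.I)).re = cos (k * z) := by
      intro z; rw [← Complex.ofReal_mul, Complex.exp_ofReal_mul_I_re]
    have him : ∀ z : ℝ, (Complex.exp ((k:ℝ) * z * Complex.I)).im = sin (k * z) := by
      intro z; rw [← Complex.ofReal_mul, Complex.exp_ofReal_mul_I_im]
    have e : Complex.exp ((k:ℝ) * x * Complex.I - ((2 * t : NNReal) : ℝ) * (k:ℝ) ^ 2 / 2) =
        (exp (-(k:ℝ) ^ 2 * t) : ℝ) * Complex.exp ((k * x : ℝ) * Complex.I) := by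
      rw [Complex.ofReal_exp, ← Complex.exp_add]
      congr 1
      push_cast
      ring
    constructor
    · have h1 := congrArg Complex.re h
      have h2 := integral_re hint
      simp only [RCLike.re_to_complex] at h2
      rw [← h2] at h1
      simp only [hre] at h1
      rw [h1, e, Complex.re_ofReal_mul, Complex.exp_ofReal_mul_I_re]
    · have h1 := congrArg Complex.im h
      have h2 := integral_im hint
      simp only [RCLike.im_to_complex] at h2
      rw [← h2] at h1
      simp only [him] at h1
      rw [h1, e, Complex.im_ofReal_mul, Complex.exp_ofReal_mul_I_im]
  unfold heatT
  have ic : ∀ k : ℤ, Integrable (fun z : ℝ => cos (k * z)) (gaussianReal x (2 * t)) := fun k =>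
    Integrable.of_bound (C := 1) (Continuous.aestronglyMeasurable (by fun_prop))
      (Filter.Eventually.of_forall fun z => abs_cos_le_one _)
  have is : ∀ k : ℤ, Integrable (fun z : ℝ => sin (k * z)) (gaussianReal x (2 * t)) := fun k =>
    Integrable.of_bound (C := 1) (Continuous.aestronglyMeasurable (by fun_prop))
      (Filter.Eventually.of_forall fun z => abs_sin_le_one _)
  simp only [mul_zero, exp_zero, one_mul]
  rw [integral_finsetSum _ (fun k _ => ((ic k).const_mul _).fun_add ((is k).const_mul _))]
  refine Finset.sum_congr rfl fun k _ => ?_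
  rw [integral_add ((ic k).const_mul _) ((is k).const_mul _), integral_const_mul,
    integral_const_mul, (key k).1, (key k).2]
  ring

open ProbabilityTheory in
lemma heatT_lower (s : Finset ℤ) (a b : ℤ → ℝ) (m : ℝ) (hm : ∀ x, m ≤ heatT s a b 0 x)
    (t : ℝ) (ht : 0 ≤ t) (x : ℝ) : m ≤ heatT s a b t x := by
  lift t to NNReal using ht
  rw [heatT_gauss]
  obtain ⟨K, hK⟩ := heatT_bound s a b
  have hi : Integrable (fun z => heatT s a b 0 z) (gaussianReal x (2 * t)) :=
    Integrable.of_bound (C := K) (Continuous.aestronglyMeasurable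
      ((heatT_cont s a b).comp (by fun_prop : Continuous fun z : ℝ => ((0:ℝ), z))))
      (Filter.Eventually.of_forall fun z => hK 0 z le_rfl)
  have := integral_mono (integrable_const m) hi hm
  simpa using this

lemma deriv_int_aux (F F' : ℝ → ℝ → ℝ) (hF : Continuous fun z : ℝ × ℝ => F z.1 z.2)
    (hF' : Continuous fun z : ℝ × ℝ => F' z.1 z.2)
    (hd : ∀ t > 0, ∀ x, HasDerivAt (fun t => F t x) (F' t x) t) (t : ℝ) (ht : 0 < t) :
    HasDerivAt (fun t => ∫ x in (0:ℝ)..(2 * π), F t x) (∫ x in (0:ℝ)..(2 * π), F' t x) t := by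
  have hab : (0:ℝ) < 2 * π := by positivity
  obtain ⟨K, hK⟩ := ((isCompact_Icc (a := t / 2) (b := t + 1)).prod
    (isCompact_Icc (a := (0:ℝ)) (b := 2 * π))).exists_bound_of_continuousOn hF'.continuousOn
  have hFt : ∀ t, Continuous (F t) := fun t =>
    hF.comp (by fun_prop : Continuous fun x : ℝ => (t, x))
  have hFt' : ∀ t, Continuous (F' t) := fun t =>
    hF'.comp (by fun_prop : Continuous fun x : ℝ => (t, x))
  refine (intervalIntegral.hasDerivAt_integral_of_dominated_loc_of_deriv_le (F := F) (F' := F')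
    (bound := fun _ => K) (s := Set.Ioo (t / 2) (t + 1)) (Ioo_mem_nhds (by linarith) (by linarith))
    ?_ ?_ ?_ ?_ ?_ ?_).2
  · exact Filter.Eventually.of_forall fun t => (hFt t).aestronglyMeasurable
  · exact (hFt t).intervalIntegrable _ _
  · exact (hFt' t).aestronglyMeasurable
  · refine Filter.Eventually.of_forall fun x hx τ hτ => ?_
    rw [Set.uIoc_of_le hab.le] at hx
    exact hK (τ, x) ⟨⟨hτ.1.le, hτ.2.le⟩, ⟨hx.1.le, hx.2⟩⟩
  · simp
  · refine Filter.Eventually.of_forall fun x hx τ hτ => hd τ (by have := hτ.1; linarith) x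

lemma heat_logSob (s : Finset ℤ) (h0s : (0:ℤ) ∉ s) (a b : ℤ → ℝ) (C m : ℝ) (hm : 0 < m)
    (hlow : ∀ x, m ≤ C + heatT s a b 0 x) :
    (∫ x in (0:ℝ)..(2 * π), (C + heatT s a b 0 x) * log (C + heatT s a b 0 x)) - 
      2 * π * (C * log C) ≤
      6 * (2 * π * C) * log (1 + (∫ x in (0:ℝ)..(2 * π),
        (heatT s (fun k => k * b k) (fun k => -(k * a k)) 0 x) ^ 2 / (C + heatT s a b 0 x)) /
          (12 * (2 * π * C))) := by
  have hab : (0:ℝ) < 2 * π := by positivity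
  set w : ℝ → ℝ → ℝ := heatT s a b with hw
  set w1 : ℝ → ℝ → ℝ := heatT s (fun k => k * b k) (fun k => -(k * a k)) with hw1
  set w2 : ℝ → ℝ → ℝ := heatT s (fun k => k * -(k * a k)) (fun k => -(k * (k * b k))) with hw2
  set w3 : ℝ → ℝ → ℝ := heatT s (fun k => k * -(k * (k * b k))) (fun k => -(k * (k * -(k * a k))))
    with hw3
  have cw : Continuous fun z : ℝ × ℝ => w z.1 z.2 := heatT_cont _ _ _
  have cw1 : Continuous fun z : ℝ × ℝ => w1 z.1 z.2 := heatT_cont _ _ _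
  have cw2 : Continuous fun z : ℝ × ℝ => w2 z.1 z.2 := heatT_cont _ _ _
  have cw3 : Continuous fun z : ℝ × ℝ => w3 z.1 z.2 := heatT_cont _ _ _
  have low : ∀ t, 0 ≤ t → ∀ x, m ≤ C + w t x := by
    intro t ht x
    have := heatT_lower s a b (m - C) (fun x => by have := hlow x; linarith) t ht x
    linarith
  set q : ℝ → ℝ → ℝ := fun t x => max m (C + w t x) with hq
  have cq : Continuous fun z : ℝ × ℝ => q z.1 z.2 := by
    simp only [hq]; fun_prop
  have qpos : ∀ t x, 0 < q t x := fun t x => lt_of_lt_of_le hm (le_max_left _ _)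
  have qne : ∀ t x, q t x ≠ 0 := fun t x => (qpos t x).ne'
  have qne' : ∀ z : ℝ × ℝ, q z.1 z.2 ≠ 0 := fun z => (qpos _ _).ne'
  have qeq : ∀ t, 0 ≤ t → ∀ x, q t x = C + w t x := fun t ht x => max_eq_right (low t ht x)
  have qd : ∀ t > 0, ∀ x, HasDerivAt (fun t => q t x) (w2 t x) t := by
    intro t ht x
    refine ((heatT_dt s a b t x).const_add C).congr_of_eventuallyEq ?_
    filter_upwards [lt_mem_nhds ht] with τ hτ
    exact qeq τ hτ.le x
  have w1d : ∀ t x, HasDerivAt (fun t => w1 t x) (w3 t x) t := by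
    intro t x
    have := heatT_dt s (fun k => k * b k) (fun k => -(k * a k)) t x
    refine this.congr_deriv ?_
    rw [hw3]
  -- mass
  have mean0 : ∀ t, ∫ x in (0:ℝ)..(2 * π), w2 t x = 0 := by
    intro t
    rw [intervalIntegral.integral_eq_sub_of_hasDerivAt (f := w1 t)
      (fun x _ => heatT_dx s _ _ t x) ((cw2.comp (by fun_prop :
        Continuous fun x : ℝ => (t, x))).intervalIntegrable _ _)]
    have := heatT_per s (fun k => k * b k) (fun k => -(k * a k)) t 0
    rw [zero_add] at this
    rw [hw1, this, sub_self]
  have meanw : ∀ t, ∫ x in (0:ℝ)..(2 * π), w t x = 0 := by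
    intro t
    have hdd : ∀ x, HasDerivAt (heatT s (fun k => -(b k / k)) (fun k => a k / k) t) (w t x) x := by
      intro x
      have := heatT_dx s (fun k => -(b k / k)) (fun k => a k / k) t x
      refine this.congr_deriv ?_
      rw [hw]
      unfold heatT
      refine Finset.sum_congr rfl fun k hk => ?_
      have hk0 : (k:ℝ) ≠ 0 := by
        have : k ≠ 0 := fun h => h0s (h ▸ hk)
        exact_mod_cast this
      field_simp
    rw [intervalIntegral.integral_eq_sub_of_hasDerivAt (fun x _ => hdd x) ((cw.comp (by fun_prop :
        Continuous fun x : ℝ => (t, x))).intervalIntegrable _ _)]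
    have := heatT_per s (fun k => -(b k / k)) (fun k => a k / k) t 0
    rw [zero_add] at this
    rw [this, sub_self]
  have cwt : ∀ t, Continuous (w t) := fun t => cw.comp (by fun_prop : Continuous fun x : ℝ => (t, x))
  have mass : ∀ t, ∫ x in (0:ℝ)..(2 * π), (C + w t x) = 2 * π * C := by
    intro t
    rw [intervalIntegral.integral_add (by simp) ((cwt t).intervalIntegrable _ _), meanw]
    simp
  have hC : 0 < C := by
    have h1 : 0 < ∫ x in (0:ℝ)..(2 * π), (C + w 0 x) :=
      intervalIntegral.intervalIntegral_pos_of_pos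
        ((continuous_const.add (cwt 0)).intervalIntegrable _ _)
        (fun x => lt_of_lt_of_le hm (low 0 le_rfl x)) hab
    rw [mass] at h1
    exact pos_of_mul_pos_right h1 hab.le
  set M := 2 * π * C with hM
  have hMpos : 0 < M := by positivity
  set S : ℝ → ℝ := fun t => ∫ x in (0:ℝ)..(2 * π), q t x * log (q t x) with hS
  set J : ℝ → ℝ := fun t => ∫ x in (0:ℝ)..(2 * π), w1 t x ^ 2 / q t x with hJ
  have cSF : Continuous fun z : ℝ × ℝ => q z.1 z.2 * log (q z.1 z.2) := by
    fun_prop (disch := assumption)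
  have cJF : Continuous fun z : ℝ × ℝ => w1 z.1 z.2 ^ 2 / q z.1 z.2 := by
    fun_prop (disch := assumption)
  have cS : Continuous S :=
    intervalIntegral.continuous_parametric_intervalIntegral_of_continuous' cSF 0 (2 * π)
  have cJ : Continuous J :=
    intervalIntegral.continuous_parametric_intervalIntegral_of_continuous' cJF 0 (2 * π)
  have Jnn : ∀ t, 0 ≤ J t := fun t => intervalIntegral.integral_nonneg hab.le fun x _ => by
    have := qpos t x
    positivity
  have dS : ∀ t > 0, HasDerivAt S (-J t) t := by
    intro t ht
    have h1 := deriv_int_aux (fun t x => q t x * log (q t x)) (fun t x => w2 t x * log (q t x) + w2 t x)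
      cSF (by fun_prop (disch := assumption)) (by
        intro t ht x
        have := qne t x
        refine ((qd t ht x).fun_mul ((qd t ht x).log (qne t x))).congr_deriv ?_
        field_simp) t ht
    refine h1.congr_deriv ?_
    have cq1 : Continuous (q t) := cq.comp (by fun_prop : Continuous fun x : ℝ => (t, x))
    have cw1t : Continuous (w1 t) := cw1.comp (by fun_prop : Continuous fun x : ℝ => (t, x))
    have cw2t : Continuous (w2 t) := cw2.comp (by fun_prop : Continuous fun x : ℝ => (t, x))
    have hne := qne t
    have hqx : ∀ x, HasDerivAt (q t) (w1 t x) x := by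
      intro x
      have : q t = fun x => C + w t x := funext (qeq t ht.le)
      rw [this]
      exact (heatT_dx s a b t x).const_add C
    have hd : ∀ x, HasDerivAt (fun x => w1 t x * log (q t x))
        (w2 t x * log (q t x) + w1 t x ^ 2 / q t x) x := by
      intro x
      refine ((heatT_dx s (fun k => k * b k) (fun k => -(k * a k)) t x).fun_mul
        ((hqx x).log (qne t x))).congr_deriv ?_
      simp only [← hw1, ← hw2]
      ring
    have c1 : Continuous fun x => w2 t x * log (q t x) := by fun_prop (disch := assumption)
    have c2 : Continuous fun x => w1 t x ^ 2 / q t x := by fun_prop (disch := assumption)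
    have h2 := intervalIntegral.integral_eq_sub_of_hasDerivAt (a := 0) (b := 2 * π)
      (fun x _ => hd x) ((c1.fun_add c2).intervalIntegrable _ _)
    rw [intervalIntegral.integral_add (c1.intervalIntegrable _ _) (c2.intervalIntegrable _ _)] at h2
    rw [intervalIntegral.integral_add (c1.intervalIntegrable _ _) (cw2t.intervalIntegrable _ _),
      mean0]
    have p1 := heatT_per s (fun k => k * b k) (fun k => -(k * a k)) t 0
    have p0 := heatT_per s a b t 0
    rw [zero_add] at p0 p1
    rw [qeq t ht.le, qeq t ht.le, hw1, p1, hw, p0, sub_self] at h2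
    simp only [hJ]
    linarith
  have dJ : ∀ t > 0, ∃ J', HasDerivAt J J' t ∧ J' ≤ -2 * (J t + J t ^ 2 / (12 * M)) := by
    intro t ht
    have h1 := deriv_int_aux (fun t x => w1 t x ^ 2 / q t x)
      (fun t x => 2 * w1 t x * w3 t x / q t x - w1 t x ^ 2 * w2 t x / q t x ^ 2)
      cJF (by
        have : ∀ z : ℝ × ℝ, q z.1 z.2 ^ 2 ≠ 0 := fun z => pow_ne_zero _ (qne' z)
        fun_prop (disch := assumption)) (by
        intro t ht x
        have := qne t x
        refine (((w1d t x).fun_pow 2).fun_div (qd t ht x) (qne t x)).congr_deriv ?_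
        field_simp
        push_cast
        ring) t ht
    refine ⟨_, h1, ?_⟩
    have hqf : q t = fun x => C + w t x := funext (qeq t ht.le)
    have p0 := heatT_per s a b t 0
    have p1 := heatT_per s (fun k => k * b k) (fun k => -(k * a k)) t 0
    have p2 := heatT_per s (fun k => k * -(k * a k)) (fun k => -(k * (k * b k))) t 0
    rw [zero_add] at p0 p1 p2
    have := core_aux (q t) (w1 t) (w2 t) (w3 t)
      (by intro x; rw [hqf]; exact (heatT_dx s a b t x).const_add C)
      (fun x => heatT_dx s _ _ t x) (fun x => heatT_dx s _ _ t x)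
      (cw3.comp (by fun_prop : Continuous fun x : ℝ => (t, x))) (qpos t)
      (by rw [hqf]; simp only [hw, p0]) p1 p2
    have hmass : ∫ x in (0:ℝ)..(2 * π), q t x = M := by rw [hqf]; exact mass t
    rw [hmass] at this
    exact this
  have den : ∀ t, 0 < 1 + J t / (12 * M) := fun t => by have := Jnn t; positivity
  set G : ℝ → ℝ := fun t => S t - 6 * M * log (1 + J t / (12 * M)) with hG
  have cG : Continuous G := by
    have : ∀ t, 1 + J t / (12 * M) ≠ 0 := fun t => (den t).ne'
    simp only [hG]
    fun_prop (disch := assumption)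
  have dG : ∀ t > 0, ∃ g, HasDerivAt G g t ∧ 0 ≤ g := by
    intro t ht
    obtain ⟨J', hJ', hle⟩ := dJ t ht
    refine ⟨_, (dS t ht).fun_sub ((((hJ'.div_const (12 * M)).const_add 1).log
      (den t).ne').const_mul (6 * M)), ?_⟩
    have h1 : 6 * M * (J' / (12 * M) / (1 + J t / (12 * M))) = (J' / 2) / (1 + J t / (12 * M)) := by
      field_simp
      ring
    rw [h1]
    have h2 : (J' / 2) / (1 + J t / (12 * M)) ≤ - J t := by
      rw [div_le_iff₀ (den t)]
      have : J t ^ 2 / (12 * M) = J t * (J t / (12 * M)) := by ring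
      rw [this] at hle
      linarith
    linarith
  have mono : MonotoneOn G (Set.Ici 0) := by
    refine monotoneOn_of_deriv_nonneg (convex_Ici 0) cG.continuousOn ?_ ?_
    · intro t ht
      rw [interior_Ici] at ht
      obtain ⟨g, hg, _⟩ := dG t ht
      exact hg.differentiableAt.differentiableWithinAt
    · intro t ht
      rw [interior_Ici] at ht
      obtain ⟨g, hg, h⟩ := dG t ht
      rw [hg.deriv]; exact h
  -- limits
  obtain ⟨K, hK⟩ := heatT_bound s a b
  obtain ⟨K1, hK1⟩ := heatT_bound s (fun k => k * b k) (fun k => -(k * a k))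
  have limq : ∀ x, Filter.Tendsto (fun t => q t x) Filter.atTop (nhds C) := by
    intro x
    have h1 : Filter.Tendsto (fun t => C + w t x) Filter.atTop (nhds (C + 0)) :=
      (heatT_tendsto s h0s a b x).const_add C
    rw [add_zero] at h1
    refine h1.congr' ?_
    filter_upwards [Filter.eventually_ge_atTop 0] with t ht
    exact (qeq t ht x).symm
  have limS : Filter.Tendsto S Filter.atTop (nhds (2 * π * (C * log C))) := by
    have e : 2 * π * (C * log C) = ∫ x in (0:ℝ)..(2 * π), C * log C := by simp; ring
    rw [e]
    obtain ⟨B, hB⟩ := (isCompact_Icc (a := m) (b := C + K)).exists_bound_of_continuousOn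
      continuous_mul_log.continuousOn
    refine intervalIntegral.tendsto_integral_filter_of_dominated_convergence (fun _ => B) ?_ ?_ ?_ ?_
    · exact Filter.Eventually.of_forall fun t => (cSF.comp (by fun_prop :
        Continuous fun x : ℝ => (t, x))).aestronglyMeasurable
    · filter_upwards [Filter.eventually_ge_atTop 0] with t ht
      refine Filter.Eventually.of_forall fun x _ => hB _ ⟨le_max_left _ _, ?_⟩
      rw [qeq t ht]
      have := (abs_le.1 (hK t x ht)).2
      linarith
    · simp
    · refine Filter.Eventually.of_forall fun x _ => ?_
      exact (continuous_mul_log.tendsto C).comp (limq x)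
  have limJ : Filter.Tendsto J Filter.atTop (nhds 0) := by
    have e : (0:ℝ) = ∫ x in (0:ℝ)..(2 * π), (0:ℝ) ^ 2 / C := by simp
    rw [e]
    refine intervalIntegral.tendsto_integral_filter_of_dominated_convergence
      (fun _ => K1 ^ 2 / m) ?_ ?_ ?_ ?_
    · exact Filter.Eventually.of_forall fun t => (cJF.comp (by fun_prop :
        Continuous fun x : ℝ => (t, x))).aestronglyMeasurable
    · filter_upwards [Filter.eventually_ge_atTop 0] with t ht
      refine Filter.Eventually.of_forall fun x _ => ?_
      have h1 := hK1 t x ht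
      have h2 : m ≤ q t x := le_max_left _ _
      have h3 := qpos t x
      rw [norm_of_nonneg (by positivity), ← sq_abs]
      gcongr
    · simp
    · refine Filter.Eventually.of_forall fun x _ => ?_
      exact ((heatT_tendsto s h0s _ _ x).pow 2).div (limq x) hC.ne'
  have limG : Filter.Tendsto G Filter.atTop (nhds (2 * π * (C * log C))) := by
    have h1 : Filter.Tendsto (fun t => 1 + J t / (12 * M)) Filter.atTop (nhds (1 + 0 / (12 * M))) :=
      (limJ.div_const _).const_add 1
    have h2 := limS.sub ((h1.log (by simp)).const_mul (6 * M))
    simpa using h2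
  have fin : G 0 ≤ 2 * π * (C * log C) := by
    refine ge_of_tendsto limG ?_
    filter_upwards [Filter.eventually_ge_atTop 0] with t ht
    exact mono (Set.mem_Ici.2 le_rfl) (Set.mem_Ici.2 ht) ht
  simp only [hG, hS, hJ] at fin
  simp only [qeq 0 le_rfl] at fin
  linarith

lemma heatT_mean (s : Finset ℤ) (h0s : (0:ℤ) ∉ s) (a b : ℤ → ℝ) (t : ℝ) :
    ∫ x in (0:ℝ)..(2 * π), heatT s a b t x = 0 := by
  have hdd : ∀ x, HasDerivAt (heatT s (fun k => -(b k / k)) (fun k => a k / k) t)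
      (heatT s a b t x) x := by
    intro x
    have := heatT_dx s (fun k => -(b k / k)) (fun k => a k / k) t x
    refine this.congr_deriv ?_
    unfold heatT
    refine Finset.sum_congr rfl fun k hk => ?_
    have hk0 : (k:ℝ) ≠ 0 := by
      have : k ≠ 0 := fun h => h0s (h ▸ hk)
      exact_mod_cast this
    field_simp
  rw [intervalIntegral.integral_eq_sub_of_hasDerivAt (fun x _ => hdd x)
    (((heatT_cont s a b).comp (by fun_prop :
        Continuous fun x : ℝ => (t, x))).intervalIntegrable _ _)]
  have := heatT_per s (fun k => -(b k / k)) (fun k => a k / k) t 0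
  rw [zero_add] at this
  rw [this, sub_self]

lemma trig_approx (h : ℝ → ℝ) (hc : Continuous h) (hp : Function.Periodic h (2 * π))
    (δ : ℝ) (hδ : 0 < δ) :
    ∃ s a b, ∀ x, |heatT s a b 0 x - h x| ≤ δ := by
  have : Fact (0 < 2 * π) := ⟨two_pi_pos⟩
  have hp' : Function.Periodic (fun x => (h x : ℂ)) (2 * π) := fun x => by simp only [hp x]
  have hcl : Continuous hp'.lift := by
    refine continuous_coinduced_dom.2 ?_
    exact Complex.continuous_ofReal.comp hc
  let f : C(AddCircle (2 * π), ℂ) := ⟨hp'.lift, hcl⟩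
  have hf : f ∈ (Submodule.span ℂ (Set.range <| @fourier (2 * π))).topologicalClosure := by
    rw [span_fourier_closure_eq_top]; trivial
  rw [← SetLike.mem_coe, Submodule.topologicalClosure_coe, Metric.mem_closure_iff] at hf
  obtain ⟨g, hg, hd⟩ := hf δ hδ
  rw [SetLike.mem_coe, Finsupp.mem_span_range_iff_exists_finsupp] at hg
  obtain ⟨c, rfl⟩ := hg
  refine ⟨c.support, fun k => (c k).re, fun k => -(c k).im, fun x => ?_⟩
  have h1 : dist (f x) ((c.sum fun i a => a • @fourier (2 * π) i) x) ≤ δ :=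
    (ContinuousMap.dist_apply_le_dist _).trans hd.le
  have h2 : f x = (h x : ℂ) := rfl
  rw [h2, dist_comm, dist_eq_norm] at h1
  have h3 := (Complex.abs_re_le_norm _).trans h1
  refine le_of_eq_of_le (congrArg abs ?_) h3
  rw [Complex.sub_re, Complex.ofReal_re]
  congr 1
  unfold heatT Finsupp.sum
  rw [ContinuousMap.sum_apply, Complex.re_sum]
  refine Finset.sum_congr rfl fun k _ => ?_
  simp only [mul_zero, exp_zero, one_mul, ContinuousMap.smul_apply, smul_eq_mul]
  rw [fourier_coe_apply]
  have e : (2 * π * Complex.I * k * x / ((2 * π : ℝ):ℂ)) = ((k * x : ℝ) : ℂ) * Complex.I := by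
    have : (π:ℂ) ≠ 0 := by exact_mod_cast pi_ne_zero
    push_cast
    field_simp
  rw [e, Complex.mul_re, Complex.exp_ofReal_mul_I_re, Complex.exp_ofReal_mul_I_im]
  ring

lemma c1_approx (r r1 : ℝ → ℝ) (h0 : ∀ x, HasDerivAt r (r1 x) x) (hc : Continuous r1)
    (hp : Function.Periodic r (2 * π)) (ε : ℝ) (hε : 0 < ε) :
    ∃ (s : Finset ℤ) (a b : ℤ → ℝ) (C : ℝ), (0:ℤ) ∉ s ∧ ∀ x, |C + heatT s a b 0 x - r x| ≤ ε ∧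
      |heatT s (fun k => k * b k) (fun k => -(k * a k)) 0 x - r1 x| ≤ ε := by
  have hab : (0:ℝ) < 2 * π := by positivity
  have hp1 : Function.Periodic r1 (2 * π) := by
    intro x
    have h1 := (h0 (x + 2 * π)).comp_add_const x (2 * π)
    have h2 : (fun x => r (x + 2 * π)) = r := funext hp
    rw [h2] at h1
    exact h1.unique (h0 x)
  set δ := ε / (2 + 4 * π) with hδ
  have hδ0 : 0 < δ := by positivity
  have hεδ : ε = 2 * δ + 4 * π * δ := by rw [hδ]; field_simp
  obtain ⟨s, a, b, happ⟩ := trig_approx r1 hc hp1 δ hδ0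
  set s' := s.erase 0 with hs'
  have h0s : (0:ℤ) ∉ s' := Finset.notMem_erase 0 s
  obtain ⟨a0, ha0⟩ : ∃ a0, ∀ x, heatT s a b 0 x = a0 + heatT s' a b 0 x := by
    by_cases h : (0:ℤ) ∈ s
    · refine ⟨a 0, fun x => ?_⟩
      unfold heatT
      rw [← Finset.add_sum_erase s _ h]
      simp [hs']
    · refine ⟨0, fun x => ?_⟩
      rw [hs', Finset.erase_eq_of_notMem h, zero_add]
  have cs : ∀ (s : Finset ℤ) (a b : ℤ → ℝ), Continuous (heatT s a b 0) := fun s a b =>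
    (heatT_cont s a b).comp (by fun_prop : Continuous fun x : ℝ => ((0:ℝ), x))
  have mr1 : ∫ x in (0:ℝ)..(2 * π), r1 x = 0 := by
    rw [intervalIntegral.integral_eq_sub_of_hasDerivAt (fun x _ => h0 x)
      (hc.intervalIntegrable _ _)]
    have := hp 0
    rw [zero_add] at this
    rw [this, sub_self]
  have ha0b : |a0| ≤ δ := by
    have h1 : ∫ x in (0:ℝ)..(2 * π), (heatT s a b 0 x - r1 x) = 2 * π * a0 := by
      rw [intervalIntegral.integral_sub ((cs s a b).intervalIntegrable _ _)
        (hc.intervalIntegrable _ _), mr1]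
      simp only [ha0]
      rw [intervalIntegral.integral_add (by simp) ((cs s' a b).intervalIntegrable _ _),
        heatT_mean s' h0s]
      simp
    have h2 := intervalIntegral.norm_integral_le_of_norm_le_const (a := 0) (b := 2 * π)
      (f := fun x => heatT s a b 0 x - r1 x) (C := δ) (fun x _ => happ x)
    rw [h1, norm_eq_abs, abs_mul, sub_zero, abs_of_pos hab, mul_comm] at h2
    exact le_of_mul_le_mul_right h2 hab
  have hder : ∀ x, heatT s' (fun k => k * (a k / k)) (fun k => -(k * -(b k / k))) 0 x
      = heatT s' a b 0 x := by
    intro x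
    unfold heatT
    refine Finset.sum_congr rfl fun k hk => ?_
    have hk0 : (k:ℝ) ≠ 0 := by
      have : k ≠ 0 := fun h => h0s (h ▸ hk)
      exact_mod_cast this
    field_simp
  have hb1 : ∀ x, |heatT s' a b 0 x - r1 x| ≤ 2 * δ := by
    intro x
    have h1 := happ x
    rw [ha0] at h1
    rw [abs_le] at *
    constructor <;> linarith [h1.1, h1.2, ha0b.1, ha0b.2]
  set A := heatT s' (fun k => -(b k / k)) (fun k => a k / k) with hA
  have hAd : ∀ x, HasDerivAt (fun x => A 0 x - r x) (heatT s' a b 0 x - r1 x) x := by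
    intro x
    refine ((heatT_dx s' (fun k => -(b k / k)) (fun k => a k / k) 0 x).fun_sub (h0 x)).congr_deriv ?_
    rw [hder]
  refine ⟨s', fun k => -(b k / k), fun k => a k / k, r 0 - A 0 0, h0s, fun x => ⟨?_, ?_⟩⟩
  · have hon : ∀ y ∈ Set.Ico 0 (2 * π), |r 0 - A 0 0 + A 0 y - r y| ≤ ε := by
      intro y hy
      have h1 := Convex.norm_image_sub_le_of_norm_hasDerivWithin_le (s := Set.univ)
        (fun x _ => (hAd x).hasDerivWithinAt) (fun x _ => hb1 x) convex_univ
        (Set.mem_univ 0) (Set.mem_univ y)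
      rw [norm_eq_abs, norm_eq_abs, sub_zero, abs_of_nonneg hy.1] at h1
      have e : r 0 - A 0 0 + A 0 y - r y = A 0 y - r y - (A 0 0 - r 0) := by ring
      rw [e]
      refine h1.trans ?_
      have := hy.2
      nlinarith
    have hperq : Function.Periodic (fun y => r 0 - A 0 0 + A 0 y - r y) (2 * π) := by
      intro y
      simp only [hp y]
      rw [hA, heatT_per]
    obtain ⟨y, hy, hxy⟩ := hperq.exists_mem_Ico₀ hab x
    rw [hxy]
    exact hon y hy
  · rw [hder]
    refine (hb1 x).trans ?_
    have : 0 ≤ 4 * π * δ := by positivity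
    linarith

lemma pos_logSob (r r1 : ℝ → ℝ) (h0 : ∀ x, HasDerivAt r (r1 x) x) (hc : Continuous r1)
    (hp : Function.Periodic r (2 * π)) (m : ℝ) (hm : 0 < m) (hlow : ∀ x, m ≤ r x) (C : ℝ)
    (hC : ∫ x in (0:ℝ)..(2 * π), r x = 2 * π * C) :
    (∫ x in (0:ℝ)..(2 * π), r x * log (r x)) - 2 * π * (C * log C) ≤
      6 * (2 * π * C) * log (1 + (∫ x in (0:ℝ)..(2 * π), (r1 x) ^ 2 / r x) /
          (12 * (2 * π * C))) := by
  have hab : (0:ℝ) < 2 * π := by positivity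
  have c0 : Continuous r := continuous_iff_continuousAt.2 fun x => (h0 x).continuousAt
  have hCpos : 0 < C := by
    have h1 : 0 < ∫ x in (0:ℝ)..(2 * π), r x :=
      intervalIntegral.intervalIntegral_pos_of_pos (c0.intervalIntegrable _ _)
        (fun x => lt_of_lt_of_le hm (hlow x)) hab
    rw [hC] at h1
    exact pos_of_mul_pos_right h1 hab.le
  obtain ⟨K, hK⟩ := (isCompact_Icc (a := (0:ℝ)) (b := 2 * π)).exists_bound_of_continuousOn
      c0.continuousOn
  obtain ⟨K1, hK1⟩ := (isCompact_Icc (a := (0:ℝ)) (b := 2 * π)).exists_bound_of_continuousOn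
      hc.continuousOn
  set δ : ℕ → ℝ := fun n => min 1 (m / 2) * (1 / ((n:ℝ) + 1)) with hδ
  have hmin : 0 < min 1 (m / 2) := by positivity
  have δpos : ∀ n, 0 < δ n := fun n => by simp only [hδ]; positivity
  have δle : ∀ n, δ n ≤ min 1 (m / 2) := fun n => by
    have : 1 / ((n:ℝ) + 1) ≤ 1 := by
      rw [div_le_one (by positivity)]; have : (0:ℝ) ≤ n := by positivity
      linarith
    simp only [hδ]
    nlinarith
  have δ1 : ∀ n, δ n ≤ 1 := fun n => (δle n).trans (min_le_left _ _)
  have δm : ∀ n, δ n ≤ m / 2 := fun n => (δle n).trans (min_le_right _ _)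
  have δlim : Filter.Tendsto δ Filter.atTop (nhds 0) := by
    simpa [hδ] using (tendsto_one_div_add_atTop_nhds_zero_nat (𝕜 := ℝ)).const_mul (min 1 (m / 2))
  choose s a b D h0s happ using fun n => c1_approx r r1 h0 hc hp (δ n) (δpos n)
  set R : ℕ → ℝ → ℝ := fun n x => D n + heatT (s n) (a n) (b n) 0 x with hR
  set R1 : ℕ → ℝ → ℝ := fun n x => heatT (s n) (fun k => k * b n k) (fun k => -(k * a n k)) 0 x
    with hR1
  have cs : ∀ (s : Finset ℤ) (a b : ℤ → ℝ), Continuous (heatT s a b 0) := fun s a b =>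
    (heatT_cont s a b).comp (by fun_prop : Continuous fun x : ℝ => ((0:ℝ), x))
  have cR : ∀ n, Continuous (R n) := fun n => continuous_const.add (cs _ _ _)
  have cR1 : ∀ n, Continuous (R1 n) := fun n => cs _ _ _
  have lowR : ∀ n x, m / 2 ≤ R n x := by
    intro n x
    have h1 := (abs_le.1 (happ n x).1).1
    have := hlow x
    have := δm n
    simp only [hR]
    linarith
  have neR : ∀ n x, R n x ≠ 0 := fun n x => by have := lowR n x; intro h; linarith
  have limR : ∀ x, Filter.Tendsto (fun n => R n x) Filter.atTop (nhds (r x)) := by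
    intro x
    rw [tendsto_iff_norm_sub_tendsto_zero]
    exact squeeze_zero (fun _ => norm_nonneg _) (fun n => (happ n x).1) δlim
  have limR1 : ∀ x, Filter.Tendsto (fun n => R1 n x) Filter.atTop (nhds (r1 x)) := by
    intro x
    rw [tendsto_iff_norm_sub_tendsto_zero]
    exact squeeze_zero (fun _ => norm_nonneg _) (fun n => (happ n x).2) δlim
  have upR : ∀ n, ∀ x ∈ Set.uIoc 0 (2 * π), R n x ≤ K + 1 := by
    intro n x hx
    rw [Set.uIoc_of_le hab.le] at hx
    have h1 := (abs_le.1 (happ n x).1).2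
    have h2 := (abs_le.1 (hK x ⟨hx.1.le, hx.2⟩)).2
    have := δ1 n
    simp only [hR]
    linarith
  have upR1 : ∀ n, ∀ x ∈ Set.uIoc 0 (2 * π), |R1 n x| ≤ K1 + 1 := by
    intro n x hx
    rw [Set.uIoc_of_le hab.le] at hx
    have h1 := abs_le.1 (happ n x).2
    have h2 := abs_le.1 (hK1 x ⟨hx.1.le, hx.2⟩)
    have := δ1 n
    simp only [hR1]
    rw [abs_le]
    constructor <;> linarith [h1.1, h1.2, h2.1, h2.2]
  have ineq : ∀ n, (∫ x in (0:ℝ)..(2 * π), R n x * log (R n x)) - 2 * π * (D n * log (D n)) ≤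
      6 * (2 * π * D n) * log (1 + (∫ x in (0:ℝ)..(2 * π), (R1 n x) ^ 2 / R n x) /
          (12 * (2 * π * D n))) := fun n =>
    heat_logSob (s n) (h0s n) (a n) (b n) (D n) (m / 2) (by positivity) (lowR n)
  have limS : Filter.Tendsto (fun n => ∫ x in (0:ℝ)..(2 * π), R n x * log (R n x)) Filter.atTop
      (nhds (∫ x in (0:ℝ)..(2 * π), r x * log (r x))) := by
    obtain ⟨B, hB⟩ := (isCompact_Icc (a := m / 2) (b := K + 1)).exists_bound_of_continuousOn
      continuous_mul_log.continuousOn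
    refine intervalIntegral.tendsto_integral_filter_of_dominated_convergence (fun _ => B) ?_ ?_ ?_ ?_
    · exact Filter.Eventually.of_forall fun n =>
        (continuous_mul_log.comp (cR n)).aestronglyMeasurable
    · exact Filter.Eventually.of_forall fun n => Filter.Eventually.of_forall fun x hx =>
        hB _ ⟨lowR n x, upR n x hx⟩
    · simp
    · exact Filter.Eventually.of_forall fun x _ => (continuous_mul_log.tendsto _).comp (limR x)
  have limJ : Filter.Tendsto (fun n => ∫ x in (0:ℝ)..(2 * π), R1 n x ^ 2 / R n x) Filter.atTop
      (nhds (∫ x in (0:ℝ)..(2 * π), r1 x ^ 2 / r x)) := by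
    refine intervalIntegral.tendsto_integral_filter_of_dominated_convergence
      (fun _ => (K1 + 1) ^ 2 / (m / 2)) ?_ ?_ ?_ ?_
    · exact Filter.Eventually.of_forall fun n =>
        (((cR1 n).pow 2).div₀ (cR n) (neR n)).aestronglyMeasurable
    · refine Filter.Eventually.of_forall fun n => Filter.Eventually.of_forall fun x hx => ?_
      have h1 := lowR n x
      have h2 := upR1 n x hx
      have h3 : 0 < R n x := by linarith
      rw [norm_of_nonneg (by positivity), ← sq_abs]
      gcongr
    · simp
    · exact Filter.Eventually.of_forall fun x _ => ((limR1 x).pow 2).div (limR x)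
        (by have := hlow x; linarith)
  have limD : Filter.Tendsto D Filter.atTop (nhds C) := by
    have h1 : Filter.Tendsto (fun n => ∫ x in (0:ℝ)..(2 * π), R n x) Filter.atTop
        (nhds (∫ x in (0:ℝ)..(2 * π), r x)) := by
      refine intervalIntegral.tendsto_integral_filter_of_dominated_convergence
        (fun _ => K + 1) ?_ ?_ ?_ ?_
      · exact Filter.Eventually.of_forall fun n => (cR n).aestronglyMeasurable
      · refine Filter.Eventually.of_forall fun n => Filter.Eventually.of_forall fun x hx => ?_
        rw [norm_of_nonneg (by have := lowR n x; linarith)]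
        exact upR n x hx
      · simp
      · exact Filter.Eventually.of_forall fun x _ => limR x
    have h2 : ∀ n, ∫ x in (0:ℝ)..(2 * π), R n x = 2 * π * D n := by
      intro n
      simp only [hR]
      rw [intervalIntegral.integral_add (by simp) ((cs _ _ _).intervalIntegrable _ _),
        heatT_mean _ (h0s n)]
      simp
    simp only [h2, hC] at h1
    have h3 := h1.div_const (2 * π)
    simpa [mul_div_cancel_left₀ _ hab.ne'] using h3
  have hJnn : 0 ≤ ∫ x in (0:ℝ)..(2 * π), r1 x ^ 2 / r x :=
    intervalIntegral.integral_nonneg hab.le fun x _ => by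
      have := hlow x
      have : 0 < r x := by linarith
      positivity
  have e1 := limS.sub (((continuous_mul_log.tendsto C).comp limD).const_mul (2 * π))
  have e2 := ((limD.const_mul (2 * π)).const_mul 6).mul (Filter.Tendsto.log
    ((limJ.div ((limD.const_mul (2 * π)).const_mul 12) (by positivity)).const_add 1) (by positivity))
  exact le_of_tendsto_of_tendsto' e1 e2 ineq

lemma exp_aux (s : ℝ) (hs : 0 ≤ s) : s ^ 2 / 2 * exp (s / 3) ≤ exp s - 1 - s := by
  have d3 : ∀ x : ℝ, HasDerivAt (fun x : ℝ => exp (x / 3)) (exp (x / 3) * (1 / 3)) x := fun x =>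
    ((hasDerivAt_id x).div_const 3).exp
  have step1 : ∀ x : ℝ, 0 ≤ x → 0 ≤ exp x - 1 - (x + x ^ 2 / 6) * exp (x / 3) := by
    have mono : MonotoneOn (fun x : ℝ => exp x - 1 - (x + x ^ 2 / 6) * exp (x / 3)) (Set.Ici 0) := by
      have hd : ∀ x : ℝ, HasDerivAt (fun x : ℝ => exp x - 1 - (x + x ^ 2 / 6) * exp (x / 3))
          (exp x - (1 + 2 * x / 3 + x ^ 2 / 18) * exp (x / 3)) x := by
        intro x
        refine (((Real.hasDerivAt_exp x).sub_const 1).fun_sub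
          (((hasDerivAt_id' x).fun_add (((hasDerivAt_id' x).fun_pow 2).div_const 6)).fun_mul (d3 x))).congr_deriv ?_
        push_cast
        ring
      refine monotoneOn_of_deriv_nonneg (convex_Ici 0)
        (fun x _ => (hd x).continuousAt.continuousWithinAt)
        (fun x _ => (hd x).differentiableAt.differentiableWithinAt) ?_
      intro x hx
      rw [interior_Ici] at hx
      have hx : 0 < x := hx
      rw [(hd x).deriv]
      have e : exp x = exp (2 * x / 3) * exp (x / 3) := by rw [← exp_add]; congr 1; ring
      rw [e, ← sub_mul]
      have := Real.quadratic_le_exp_of_nonneg (x := 2 * x / 3) (by positivity)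
      refine mul_nonneg ?_ (exp_pos _).le
      nlinarith [sq_nonneg x]
    intro x hx
    have := mono (Set.mem_Ici.2 le_rfl) (Set.mem_Ici.2 hx) hx
    simpa using this
  have mono : MonotoneOn (fun x : ℝ => exp x - 1 - x - x ^ 2 / 2 * exp (x / 3)) (Set.Ici 0) := by
    have hd : ∀ x : ℝ, HasDerivAt (fun x : ℝ => exp x - 1 - x - x ^ 2 / 2 * exp (x / 3))
        (exp x - 1 - (x + x ^ 2 / 6) * exp (x / 3)) x := by
      intro x
      refine ((((Real.hasDerivAt_exp x).sub_const 1).fun_sub (hasDerivAt_id' x)).fun_sub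
        ((((hasDerivAt_id' x).fun_pow 2).div_const 2).fun_mul (d3 x))).congr_deriv ?_
      push_cast
      ring
    refine monotoneOn_of_deriv_nonneg (convex_Ici 0)
      (fun x _ => (hd x).continuousAt.continuousWithinAt)
      (fun x _ => (hd x).differentiableAt.differentiableWithinAt) ?_
    intro x hx
    rw [interior_Ici] at hx
    rw [(hd x).deriv]
    exact step1 x (le_of_lt hx)
  have := mono (Set.mem_Ici.2 le_rfl) (Set.mem_Ici.2 hs) hs
  simp at this
  linarith

lemma num_aux (p E : ℝ) (hp : 2 < p) (hE : 0 ≤ E) :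
    (p - 1) ^ 2 / (2 * p * (2 * p - 1)) * E ^ p ≤
      12 / p ^ 2 * (exp (p ^ 2 * E / 12) - 1 - p ^ 2 * E / 12) := by
  rcases hE.eq_or_lt with rfl | hE
  · rw [zero_rpow (by linarith)]; simp
  have h1 := exp_aux (p ^ 2 * E / 12) (by positivity)
  obtain ⟨q, rfl⟩ : ∃ q, p = q + 2 := ⟨p - 2, by ring⟩
  have hq : 0 < q := by linarith
  have h2p : 0 < 2 * (q + 2) - 1 := by linarith
  have hp0 : 0 < q + 2 := by linarith
  have hp1 : 0 < q + 2 - 1 := by linarith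
  have hEp : E ^ (q + 2) = E ^ q * E ^ 2 := by
    rw [rpow_add hE, ← rpow_natCast]; norm_num
  set X := exp (q * (9 * q / (q + 2) ^ 2 + log 4 - 2)) with hX
  have hEq : E ^ q ≤ exp ((q + 2) ^ 2 * E / 36) * X := by
    rw [rpow_def_of_pos hE, hX, ← exp_add, exp_le_exp]
    have l1 : log (E / (36 * q / (q + 2) ^ 2)) ≤ E / (36 * q / (q + 2) ^ 2) - 1 :=
      log_le_sub_one_of_pos (by positivity)
    have l2 : log (9 * q / (q + 2) ^ 2) ≤ 9 * q / (q + 2) ^ 2 - 1 :=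
      log_le_sub_one_of_pos (by positivity)
    rw [log_div (by positivity) (by positivity)] at l1
    have e1 : 36 * q / (q + 2) ^ 2 = 4 * (9 * q / (q + 2) ^ 2) := by ring
    have e2 : log (36 * q / (q + 2) ^ 2) = log 4 + log (9 * q / (q + 2) ^ 2) := by
      rw [e1, log_mul (by norm_num) (by positivity)]
    have l3 : log E ≤ E / (36 * q / (q + 2) ^ 2) + (9 * q / (q + 2) ^ 2 + log 4 - 2) := by
      linarith
    have l4 := mul_le_mul_of_nonneg_left l3 hq.le
    have e3 : q * (E / (36 * q / (q + 2) ^ 2)) = (q + 2) ^ 2 * E / 36 := by field_simp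
    rw [mul_add, e3] at l4
    linarith
  have hXle : X ≤ (q + 2) ^ 3 * (2 * (q + 2) - 1) / (12 * (q + 2 - 1) ^ 2) := by
    set Y := (q + 2) ^ 3 * (2 * (q + 2) - 1) / (12 * (q + 2 - 1) ^ 2) with hY
    have hYp : 0 < Y := by positivity
    rw [hX, ← le_log_iff_exp_le hYp]
    have l1 : log (4 / Y) ≤ 4 / Y - 1 := log_le_sub_one_of_pos (by positivity)
    rw [log_div (by norm_num) hYp.ne'] at l1
    have l4 : log 4 = 2 * log 2 := by
      rw [show (4:ℝ) = 2 ^ 2 by norm_num, log_pow]; norm_num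
    have g1 := Real.log_two_gt_d9
    have g2 := Real.log_two_lt_d9
    have poly : 9 * q ^ 2 / (q + 2) ^ 2 - 0.6137 * q ≤ 2.3862 - 4 / Y := by
      have eY : 4 / Y = 48 * (q + 1) ^ 2 / ((q + 2) ^ 3 * (2 * q + 3)) := by
        rw [hY]
        have : 2 * (q + 2) - 1 = 2 * q + 3 := by ring
        have h' : q + 2 - 1 = q + 1 := by ring
        rw [this, h']
        field_simp
        ring
      rw [eY]
      have e : 2.3862 - 48 * (q + 1) ^ 2 / ((q + 2) ^ 3 * (2 * q + 3)) -
          (9 * q ^ 2 / (q + 2) ^ 2 - 0.6137 * q) =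
          ((2.3862 + 0.6137 * q) * ((q + 2) ^ 3 * (2 * q + 3)) - 48 * (q + 1) ^ 2
            - 9 * q ^ 2 * (q + 2) * (2 * q + 3)) / ((q + 2) ^ 3 * (2 * q + 3)) := by
        field_simp
        ring
      have num : 0 ≤ (2.3862 + 0.6137 * q) * ((q + 2) ^ 3 * (2 * q + 3)) - 48 * (q + 1) ^ 2
            - 9 * q ^ 2 * (q + 2) * (2 * q + 3) := by
        have c : 0 ≤ 1.2274 * q ^ 3 - 4.03 * q ^ 2 - 1.5 * q + 30 := by
          nlinarith [mul_nonneg hq.le (sq_nonneg (q - 2.35)), sq_nonneg (q - 2.35)]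
        have := mul_nonneg (sq_nonneg q) c
        nlinarith [pow_pos hq 2, pow_pos hq 3, pow_pos hq 4]
      have := div_nonneg num (by positivity : 0 ≤ (q + 2) ^ 3 * (2 * q + 3))
      linarith
    have : q * (9 * q / (q + 2) ^ 2 + log 4 - 2) = 9 * q ^ 2 / (q + 2) ^ 2 + q * (log 4 - 2) := by
      ring
    rw [this]
    have : q * (log 4 - 2) ≤ q * (-0.6137) := by
      apply mul_le_mul_of_nonneg_left _ hq.le
      linarith
    linarith
  have h3 : E ^ q ≤ exp ((q + 2) ^ 2 * E / 36) *
      ((q + 2) ^ 3 * (2 * (q + 2) - 1) / (12 * (q + 2 - 1) ^ 2)) :=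
    hEq.trans (by gcongr)
  have e36 : (q + 2) ^ 2 * E / 12 / 3 = (q + 2) ^ 2 * E / 36 := by ring
  rw [e36] at h1
  calc (q + 2 - 1) ^ 2 / (2 * (q + 2) * (2 * (q + 2) - 1)) * E ^ (q + 2)
      ≤ (q + 2 - 1) ^ 2 / (2 * (q + 2) * (2 * (q + 2) - 1)) * (exp ((q + 2) ^ 2 * E / 36) *
      ((q + 2) ^ 3 * (2 * (q + 2) - 1) / (12 * (q + 2 - 1) ^ 2)) * E ^ 2) := by
        rw [hEp]; gcongr
    _ = 12 / (q + 2) ^ 2 * (((q + 2) ^ 2 * E / 12) ^ 2 / 2 * exp ((q + 2) ^ 2 * E / 36)) := by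
        field_simp
    _ ≤ _ := by gcongr

lemma lambdaOne_nonneg (p : ℝ) : 0 ≤ lambdaOne p := by
  refine Real.sInf_nonneg ?_
  rintro l ⟨v, _, _, _, rfl⟩
  positivity

lemma lambdaOne_le_one (p : ℝ) : lambdaOne p ≤ 1 := by
  have hmem : perNorm p (deriv cos) ^ 2 / perNorm p cos ^ 2 ∈ { l : ℝ | ∃ v : ℝ → ℝ,
      PeriodicC1 v ∧ v ≠ 0 ∧ (∫ x in (0:ℝ)..(2 * π), v x) = 0 ∧
      l = (perNorm p (deriv v)) ^ 2 / (perNorm p v) ^ 2 } := by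
    refine ⟨cos, ⟨cos_periodic, contDiff_cos⟩, ?_, ?_, rfl⟩
    · intro h
      have := congrFun h 0
      simp at this
    · simp
  have h1 : lambdaOne p ≤ perNorm p (deriv cos) ^ 2 / perNorm p cos ^ 2 := by
    refine csInf_le ⟨0, ?_⟩ hmem
    rintro l ⟨v, _, _, _, rfl⟩
    positivity
  refine h1.trans ?_
  have h2 : perNorm p (deriv cos) = perNorm p cos := by
    unfold perNorm
    congr 2
    have e1 : ∀ x, |deriv cos x| ^ p = |cos (x + π / 2)| ^ p := by
      intro x; rw [Real.deriv_cos, cos_add_pi_div_two]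
    simp only [e1]
    have hper : Function.Periodic (fun x => |cos x| ^ p) (2 * π) := fun x => by
      simp only [cos_periodic x]
    rw [intervalIntegral.integral_comp_add_right (fun x => |cos x| ^ p)]
    have := hper.intervalIntegral_add_eq (π / 2) 0
    rw [zero_add] at this
    rw [zero_add, add_comm (2 * π), this]
  rw [h2]
  exact div_self_le_one _

lemma logSob_u (p : ℝ) (hp : 2 < p) (u : ℝ → ℝ) (hu : PeriodicC1 u) (C : ℝ) (hC : 0 < C)
    (hmass : ∫ x in (0:ℝ)..(2 * π), |u x| ^ p = 2 * π * C) :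
    (∫ x in (0:ℝ)..(2 * π), |u x| ^ p * log (|u x| ^ p)) - 2 * π * (C * log C) ≤
      6 * (2 * π * C) * log (1 + (p ^ 2 * ∫ x in (0:ℝ)..(2 * π), |u x| ^ (p - 2) * |deriv u x| ^ (2:ℝ)) /
          (12 * (2 * π * C))) := by
  have hab : (0:ℝ) < 2 * π := by positivity
  obtain ⟨hper, hcd⟩ := hu
  have cu : Continuous u := hcd.continuous
  have cu' : Continuous (deriv u) := hcd.continuous_deriv le_rfl
  have hud : ∀ x, HasDerivAt u (deriv u x) x := fun x =>
    (hcd.differentiable (by norm_num) x).hasDerivAt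
  have cup : ∀ r : ℝ, 0 < r → Continuous fun x => |u x| ^ r := fun r hr =>
    cu.abs.rpow_const fun x => Or.inr hr.le
  have cH : Continuous fun x => |u x| ^ (p - 2) * |deriv u x| ^ (2:ℝ) :=
    (cup _ (by linarith)).mul (cu'.abs.rpow_const fun x => Or.inr (by norm_num))
  set H := ∫ x in (0:ℝ)..(2 * π), |u x| ^ (p - 2) * |deriv u x| ^ (2:ℝ) with hH
  have hHnn : 0 ≤ H := intervalIntegral.integral_nonneg hab.le fun x _ => by positivity
  have cp := cup p (by linarith)
  have hE : ∀ ε > 0, (∫ x in (0:ℝ)..(2 * π), (|u x| ^ p + ε) * log (|u x| ^ p + ε))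
        - 2 * π * ((C + ε) * log (C + ε)) ≤
      6 * (2 * π * (C + ε)) * log (1 + (p ^ 2 * H) / (12 * (2 * π * (C + ε)))) := by
    intro ε hε
    have hd : ∀ x, HasDerivAt (fun x => |u x| ^ p + ε) (p * |u x| ^ (p - 2) * u x * deriv u x) x :=
      fun x => (((hasDerivAt_abs_rpow (u x) (by linarith : 1 < p)).comp x (hud x)).add_const ε)
    have cd : Continuous fun x => p * |u x| ^ (p - 2) * u x * deriv u x :=
      (((cup (p - 2) (by linarith)).const_mul p).mul cu).mul cu'
    have hnn : ∀ x, 0 ≤ |u x| ^ p := fun x => by positivity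
    have main := pos_logSob _ _ hd cd (fun x => by simp only [hper x]) ε hε
      (fun x => by have := hnn x; linarith) (C + ε) (by
        rw [intervalIntegral.integral_add (cp.intervalIntegrable _ _) (by simp), hmass]
        simp; ring)
    refine main.trans ?_
    have hJnn : 0 ≤ ∫ x in (0:ℝ)..(2 * π), (p * |u x| ^ (p - 2) * u x * deriv u x) ^ 2 / (|u x| ^ p + ε) :=
      intervalIntegral.integral_nonneg hab.le fun x _ =>
        div_nonneg (sq_nonneg _) (add_nonneg (hnn x) hε.le)
    have hJle : ∫ x in (0:ℝ)..(2 * π), (p * |u x| ^ (p - 2) * u x * deriv u x) ^ 2 / (|u x| ^ p + ε)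
        ≤ p ^ 2 * H := by
      rw [hH, ← intervalIntegral.integral_const_mul]
      refine intervalIntegral.integral_mono_on hab.le ?_ ?_ ?_
      · exact ((cd.pow 2).div₀ (cp.add continuous_const) fun x =>
          (add_pos_of_nonneg_of_pos (hnn x) hε).ne').intervalIntegrable _ _
      · exact (cH.const_mul _).intervalIntegrable _ _
      · intro x _
        have h1 := hnn x
        rw [div_le_iff₀ (by positivity)]
        have e1 : |u x| ^ (p - 2) * u x ^ 2 = |u x| ^ p := by
          by_cases h0 : u x = 0
          · rw [h0]
            simp [zero_rpow (by linarith : p ≠ 0)]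
          · have h3 : 0 < |u x| := abs_pos.2 h0
            rw [← sq_abs, ← rpow_natCast, ← rpow_add h3]
            norm_num
        have e2 : |deriv u x| ^ (2:ℝ) = deriv u x ^ 2 := by
          rw [rpow_two, sq_abs]
        rw [e2]
        have e3 : (p * |u x| ^ (p - 2) * u x * deriv u x) ^ 2 =
            p ^ 2 * (|u x| ^ (p - 2) * deriv u x ^ 2) * (|u x| ^ (p - 2) * u x ^ 2) := by ring
        rw [e3, e1]
        apply mul_le_mul_of_nonneg_left _ (by positivity)
        linarith
    gcongr
  have t1 : Filter.Tendsto (fun ε : ℝ => (∫ x in (0:ℝ)..(2 * π), (|u x| ^ p + ε) * log (|u x| ^ p + ε))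
        - 2 * π * ((C + ε) * log (C + ε))) (nhdsWithin 0 (Set.Ioi 0))
        (nhds ((∫ x in (0:ℝ)..(2 * π), (|u x| ^ p + 0) * log (|u x| ^ p + 0))
        - 2 * π * ((C + 0) * log (C + 0)))) := by
    refine (Continuous.tendsto ?_ 0).mono_left nhdsWithin_le_nhds
    refine Continuous.sub ?_ ?_
    · refine intervalIntegral.continuous_parametric_intervalIntegral_of_continuous'
        (f := fun ε x => (|u x| ^ p + ε) * log (|u x| ^ p + ε)) ?_ 0 (2 * π)
      exact continuous_mul_log.comp ((cp.comp continuous_snd).add continuous_fst)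
    · exact (continuous_mul_log.comp (continuous_const.add continuous_id)).const_mul _
  have t2 : Filter.Tendsto (fun ε : ℝ => 6 * (2 * π * (C + ε)) *
      log (1 + (p ^ 2 * H) / (12 * (2 * π * (C + ε))))) (nhdsWithin 0 (Set.Ioi 0))
        (nhds (6 * (2 * π * (C + 0)) * log (1 + (p ^ 2 * H) / (12 * (2 * π * (C + 0)))))) := by
    refine (ContinuousAt.tendsto ?_).mono_left nhdsWithin_le_nhds
    have hne : 12 * (2 * π * (C + 0)) ≠ 0 := by rw [add_zero]; positivity
    have hne2 : 1 + (p ^ 2 * H) / (12 * (2 * π * (C + 0))) ≠ 0 := by rw [add_zero]; positivity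
    fun_prop (disch := assumption)
  have := le_of_tendsto_of_tendsto t1 t2 (by
    filter_upwards [self_mem_nhdsWithin] with ε hε
    exact hE ε hε)
  simpa using this

lemma holder_aux (p : ℝ) (hp : 2 < p) (f g : ℝ → ℝ) (hf : Continuous f) (hg : Continuous g) :
    ∫ x in (0:ℝ)..(2 * π), |f x| ^ (p - 2) * |g x| ^ (2:ℝ) ≤
      (∫ x in (0:ℝ)..(2 * π), |f x| ^ p) ^ ((p - 2) / p) *
      (∫ x in (0:ℝ)..(2 * π), |g x| ^ p) ^ (2 / p) := by
  have hab : (0:ℝ) < 2 * π := by positivity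
  have hpq : (p / (p - 2)).HolderConjugate (p / 2) := by
    have h2 : p - 2 ≠ 0 := by linarith
    have h3 : p ≠ 0 := by linarith
    refine ⟨?_, div_pos (by linarith) (by linarith), div_pos (by linarith) (by norm_num)⟩
    rw [inv_div, inv_div, inv_one]
    field_simp
    ring
  have mem : ∀ (h : ℝ → ℝ) (r : ENNReal), Continuous h →
      MemLp h r (volume.restrict (Set.Ioc 0 (2 * π))) := by
    intro h r hh
    obtain ⟨K, hK⟩ := (isCompact_Icc (a := (0:ℝ)) (b := 2 * π)).exists_bound_of_continuousOn
      hh.continuousOn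
    refine MemLp.of_bound hh.aestronglyMeasurable K ?_
    filter_upwards [ae_restrict_mem measurableSet_Ioc] with x hx
    exact hK x ⟨hx.1.le, hx.2⟩
  have h := integral_mul_le_Lp_mul_Lq_of_nonneg (μ := volume.restrict (Set.Ioc 0 (2 * π))) hpq
    (f := fun x => |f x| ^ (p - 2)) (g := fun x => |g x| ^ (2:ℝ))
    (Filter.Eventually.of_forall fun x => by positivity)
    (Filter.Eventually.of_forall fun x => by positivity)
    (mem _ _ (hf.abs.rpow_const fun x => Or.inr (by linarith)))
    (mem _ _ (hg.abs.rpow_const fun x => Or.inr (by norm_num)))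
  have e1 : ∀ x, (|f x| ^ (p - 2)) ^ (p / (p - 2)) = |f x| ^ p := fun x => by
    rw [← rpow_mul (abs_nonneg _)]; congr 1; have : p - 2 ≠ 0 := by linarith
    field_simp
  have e2 : ∀ x, (|g x| ^ (2:ℝ)) ^ (p / 2) = |g x| ^ p := fun x => by
    rw [← rpow_mul (abs_nonneg _)]; congr 1; field_simp
  simp only [e1, e2, one_div_div] at h
  simp only [intervalIntegral.integral_of_le hab.le]
  exact h

/-- improved L^p logarithmic Sobolev inequality (Theorem 3.1, q = p). -/
theorem improved_logSob (p : ℝ) (hp : 2 < p)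
    (u : ℝ → ℝ) (hu : PeriodicC1 u) (hu0 : u ≠ 0)
    (E a : ℝ)
    (hE : E = (2 / p) * ((1 / (2 * π)) * ∫ x in (0:ℝ)..(2 * π),
      (|u x| ^ p / (perNorm p u) ^ p) * Real.log (|u x| / perNorm p u)))
    (ha : a = ((p - 1) ^ 2 / (2 * p * (2 * p - 1))) * (lambdaOne p) ^ (p - 2)) :
    (perNorm p (deriv u)) ^ 2 ≥
      lambdaOne p * (perNorm p u) ^ 2 * (E + a * E ^ p) := by
  have hab : (0:ℝ) < 2 * π := by positivity
  have hp0 : 0 < p := by linarith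
  have hper := hu.1
  have hcd := hu.2
  have cu : Continuous u := hcd.continuous
  have cu' : Continuous (deriv u) := hcd.continuous_deriv le_rfl
  have cp : Continuous fun x => |u x| ^ p := cu.abs.rpow_const fun x => Or.inr hp0.le
  set P := ∫ x in (0:ℝ)..(2 * π), |u x| ^ p with hP
  set Q := ∫ x in (0:ℝ)..(2 * π), |deriv u x| ^ p with hQ
  have hQnn : 0 ≤ Q := intervalIntegral.integral_nonneg hab.le fun x _ => by positivity
  have hPpos : 0 < P := by
    obtain ⟨x0, hx0⟩ : ∃ x, u x ≠ 0 := by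
      by_contra h
      push Not at h
      exact hu0 (funext h)
    obtain ⟨y, hy, hxy⟩ := hper.exists_mem_Ico₀ hab x0
    refine intervalIntegral.integral_pos hab cp.continuousOn (fun x _ => by positivity)
      ⟨y, ⟨hy.1, hy.2.le⟩, ?_⟩
    have : 0 < |u y| := by rw [← hxy]; exact abs_pos.2 hx0
    positivity
  set C := 1 / (2 * π) * P with hC
  have hCpos : 0 < C := by positivity
  have hPC : P = 2 * π * C := by rw [hC]; field_simp
  set N := perNorm p u with hN
  set L := perNorm p (deriv u) with hL
  have hNC : N = C ^ (1 / p) := rfl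
  have hNpos : 0 < N := by rw [hNC]; positivity
  have hNp : N ^ p = C := by
    rw [hNC, ← rpow_mul hCpos.le, one_div_mul_cancel hp0.ne', rpow_one]
  have hLQ : L = (1 / (2 * π) * Q) ^ (1 / p) := rfl
  have hLnn : 0 ≤ L := by rw [hLQ]; positivity
  clear_value C N L
  set S := ∫ x in (0:ℝ)..(2 * π), |u x| ^ p * log (|u x| ^ p) with hS
  have cS : Continuous fun x => |u x| ^ p * log (|u x| ^ p) := continuous_mul_log.comp cp
  -- rewrite E
  have hES : E = 2 / p * (1 / (2 * π) * ((1 / (p * C)) * (S - P * log C))) := by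
    have key : ∫ x in (0:ℝ)..(2 * π), (|u x| ^ p / N ^ p) * Real.log (|u x| / N) =
        ∫ x in (0:ℝ)..(2 * π), 1 / (p * C) *
          (|u x| ^ p * log (|u x| ^ p) - |u x| ^ p * log C) := by
      refine intervalIntegral.integral_congr fun x _ => ?_
      beta_reduce
      rw [hNp]
      by_cases h0 : u x = 0
      · rw [h0]; simp [zero_rpow hp0.ne']
      · have h3 : 0 < |u x| := abs_pos.2 h0
        have h4 : log C = p * log N := by rw [← hNp, log_rpow hNpos]
        rw [log_div h3.ne' hNpos.ne', log_rpow h3, h4]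
        field_simp
    rw [intervalIntegral.integral_const_mul, intervalIntegral.integral_sub
      (cS.intervalIntegrable _ _) ((cp.mul_const _).intervalIntegrable _ _),
      intervalIntegral.integral_mul_const] at key
    rw [hE, key]
  have hS2 : S - P * log C = E * p ^ 2 * π * C := by
    rw [hES]; field_simp
  have hEnn : 0 ≤ E := by
    have h1 : 0 ≤ S - P * log C := by
      have h2 : ∫ x in (0:ℝ)..(2 * π), (|u x| ^ p - C) ≤ ∫ x in (0:ℝ)..(2 * π),
          (|u x| ^ p * log (|u x| ^ p) - |u x| ^ p * log C) := by
        refine intervalIntegral.integral_mono_on hab.le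
          ((cp.sub continuous_const).intervalIntegrable _ _)
          ((cS.sub (cp.mul_const _)).intervalIntegrable _ _) fun x _ => ?_
        have hy : 0 ≤ |u x| ^ p := by positivity
        generalize |u x| ^ p = y at hy
        rcases hy.eq_or_lt with rfl | hy
        · simp; exact hCpos.le
        · have h5 := log_le_sub_one_of_pos (div_pos hCpos hy)
          rw [log_div hCpos.ne' hy.ne'] at h5
          have h6 := mul_le_mul_of_nonneg_left h5 hy.le
          have : y * (C / y - 1) = C - y := by field_simp
          rw [this] at h6
          linarith
      rw [intervalIntegral.integral_sub (cp.intervalIntegrable _ _) (by simp),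
        intervalIntegral.integral_sub (cS.intervalIntegrable _ _)
          ((cp.mul_const _).intervalIntegrable _ _)] at h2
      have i1 : ∫ x in (0:ℝ)..(2 * π), |u x| ^ p * log C = P * log C := by
        rw [intervalIntegral.integral_mul_const]
      have i2 : ∫ x in (0:ℝ)..(2 * π), C = 2 * π * C := by
        rw [intervalIntegral.integral_const, sub_zero, smul_eq_mul]
      rw [i1, i2] at h2
      linarith [hPC]
    rw [hS2] at h1
    by_contra hneg
    push Not at hneg
    have : E * p ^ 2 * π * C < 0 := by
      have : 0 < p ^ 2 * π * C := by positivity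
      nlinarith
    linarith
  have main := logSob_u p hp u hu C hCpos hPC
  set H := ∫ x in (0:ℝ)..(2 * π), |u x| ^ (p - 2) * |deriv u x| ^ (2:ℝ) with hH
  have hHnn : 0 ≤ H := intervalIntegral.integral_nonneg hab.le fun x _ => by positivity
  have hold : H ≤ P ^ ((p - 2) / p) * Q ^ (2 / p) := holder_aux p hp u (deriv u) cu cu'
  have hold2 : H ≤ 2 * π * (N ^ (p - 2) * L ^ 2) := by
    refine hold.trans (le_of_eq ?_)
    have e1 : P ^ ((p - 2) / p) = (2 * π) ^ ((p - 2) / p) * N ^ (p - 2) := by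
      rw [hPC, mul_rpow hab.le hCpos.le, hNC, ← rpow_mul hCpos.le]
      congr 2; ring
    have e2 : Q ^ (2 / p) = (2 * π) ^ (2 / p) * L ^ 2 := by
      have hQ2 : Q = 2 * π * (1 / (2 * π) * Q) := by field_simp
      have hnn : 0 ≤ 1 / (2 * π) * Q := by positivity
      rw [hLQ, ← rpow_natCast, ← rpow_mul hnn]
      conv_lhs => rw [hQ2]
      rw [mul_rpow hab.le hnn]
      congr 2; push_cast; ring
    rw [e1, e2]
    have e3 : (2 * π) ^ ((p - 2) / p) * (2 * π) ^ (2 / p) = 2 * π := by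
      rw [← rpow_add hab]
      have : (p - 2) / p + 2 / p = 1 := by field_simp; ring
      rw [this, rpow_one]
    calc _ = ((2 * π) ^ ((p - 2) / p) * (2 * π) ^ (2 / p)) * (N ^ (p - 2) * L ^ 2) := by ring
      _ = _ := by rw [e3]
  set R := L ^ 2 / N ^ 2 with hR
  have hRnn : 0 ≤ R := by positivity
  have hHR : H / (2 * π * C) ≤ R := by
    rw [div_le_iff₀ (by positivity)]
    refine hold2.trans (le_of_eq ?_)
    have : C = N ^ (p - 2) * N ^ 2 := by
      rw [← hNp, ← rpow_natCast, ← rpow_add hNpos]; norm_num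
    rw [this, hR]
    field_simp
  have hlog : p ^ 2 * E / 12 ≤ log (1 + p ^ 2 * R / 12) := by
    have h1 : log (1 + p ^ 2 * H / (12 * (2 * π * C))) ≤ log (1 + p ^ 2 * R / 12) := by
      apply log_le_log (by positivity)
      have : p ^ 2 * H / (12 * (2 * π * C)) = p ^ 2 / 12 * (H / (2 * π * C)) := by field_simp
      rw [this]
      have : p ^ 2 * R / 12 = p ^ 2 / 12 * R := by ring
      rw [this]
      gcongr
    refine le_trans ?_ h1
    have h2 : 2 * π * (C * log C) = P * log C := by rw [hPC]; ring
    rw [h2, hS2] at main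
    have h3 : E * p ^ 2 * π * C = 6 * (2 * π * C) * (p ^ 2 * E / 12) := by ring
    rw [h3] at main
    exact le_of_mul_le_mul_left main (by positivity)
  have hexp : exp (p ^ 2 * E / 12) ≤ 1 + p ^ 2 * R / 12 := by
    rwa [← le_log_iff_exp_le (by positivity)]
  have hnum := num_aux p E hp hEnn
  have hfin : E + (p - 1) ^ 2 / (2 * p * (2 * p - 1)) * E ^ p ≤ R := by
    have h1 : 12 / p ^ 2 * (exp (p ^ 2 * E / 12) - 1 - p ^ 2 * E / 12) ≤
        12 / p ^ 2 * (p ^ 2 * R / 12 - p ^ 2 * E / 12) := by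
      gcongr; linarith
    have h2 : 12 / p ^ 2 * (p ^ 2 * R / 12 - p ^ 2 * E / 12) = R - E := by field_simp
    linarith
  have hl0 := lambdaOne_nonneg p
  have hl1 := lambdaOne_le_one p
  have hc : 0 < (p - 1) ^ 2 / (2 * p * (2 * p - 1)) := by
    have h1 : 0 < p - 1 := by linarith
    have h2 : 0 < 2 * p - 1 := by linarith
    positivity
  have hEp : 0 ≤ E ^ p := by positivity
  have hlp : lambdaOne p ^ (p - 2) ≤ 1 := rpow_le_one hl0 hl1 (by linarith)
  have ha1 : a ≤ (p - 1) ^ 2 / (2 * p * (2 * p - 1)) := by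
    rw [ha]; exact mul_le_of_le_one_right hc.le hlp
  have ha0 : 0 ≤ a := by rw [ha]; positivity
  have h1 : E + a * E ^ p ≤ R := le_trans (by gcongr) hfin
  have h2 : lambdaOne p * (E + a * E ^ p) ≤ R := by
    refine le_trans (mul_le_of_le_one_left (by positivity) hl1) h1
  have h3 : L ^ 2 = N ^ 2 * R := by rw [hR]; field_simp
  rw [ge_iff_le, h3]
  calc lambdaOne p * N ^ 2 * (E + a * E ^ p) = N ^ 2 * (lambdaOne p * (E + a * E ^ p)) := by ring
    _ ≤ N ^ 2 * R := by gcongr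
end

section
/- Let p > 1 and define Λ₁ := inf{‖u'‖_p^p / ‖u‖_p^p : u 2π-periodic, C¹, not identically zero, ∫₀^{2π} |u(x)|^{p−2}u(x) dx = 0}. Then λ₁ = Λ₁^{2/p}, i.e. λ₁^{p/2} = Λ₁. -/
open MeasureTheory Real

lemma aux_mono {D D' : ℝ → ℝ} (hD : ∀ x, HasDerivAt D (D' x) x) (h0 : D 0 = 0)
    (hn : ∀ x, 0 < x → 0 ≤ D' x) {x : ℝ} (hx : 0 ≤ x) : 0 ≤ D x := by
  have : MonotoneOn D (Set.Ici 0) := by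
    apply monotoneOn_of_deriv_nonneg (convex_Ici 0)
    · exact fun x _ => (hD x).continuousAt.continuousWithinAt
    · exact fun x _ => (hD x).differentiableAt.differentiableWithinAt
    · intro x hx
      rw [interior_Ici] at hx
      rw [(hD x).deriv]; exact hn x hx
  have := this (Set.mem_Ici.2 le_rfl) (Set.mem_Ici.2 hx) hx
  rwa [h0] at this

lemma sinh_bound (n : ℝ) (hn : 0 < n) {x : ℝ} (hx : 0 ≤ x) :
    sinh (n * x) * cosh x ≤ (n + 1) * (sinh x * cosh (n * x)) := by
  have hl : ∀ x : ℝ, HasDerivAt (fun x : ℝ => n * x) n x := fun x => by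
    simpa using (hasDerivAt_id x).const_mul n
  have key := aux_mono (D := fun x => (n + 1) * (sinh x * cosh (n * x)) - sinh (n * x) * cosh x)
    (fun x => (((Real.hasDerivAt_sinh x).mul ((hl x).cosh)).const_mul (n+1)).sub
      (((hl x).sinh).mul (Real.hasDerivAt_cosh x))) (by simp) (by
      intro x hx
      have h1 : 0 ≤ sinh x * sinh (n*x) :=
        mul_nonneg (sinh_nonneg_iff.2 hx.le) (sinh_nonneg_iff.2 (by positivity))
      have h2 : 0 < cosh x * cosh (n * x) - sinh x * sinh (n * x) := by
        rw [← Real.cosh_sub]; exact cosh_pos _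
      have h3 : 0 ≤ (n^2+n) * (sinh x * sinh (n*x)) := by positivity
      nlinarith) hx
  linarith [key]

lemma D_nonneg (n : ℝ) (hn : 0 < n) {x : ℝ} (hx : 0 ≤ x) :
    (n + 4) * (log (cosh (n * x)) - (n + 2) * log (cosh x)) ≤
    n * (n + 1) * (sinh x * cosh x * (sinh (n * x) / cosh (n * x)) + sinh x ^ 2) := by
  have hl : ∀ x : ℝ, HasDerivAt (fun x : ℝ => n * x) n x := fun x => by
    simpa using (hasDerivAt_id x).const_mul n
  have key := aux_mono (D := fun x => n * (n + 1) * (sinh x * cosh x * (sinh (n * x) / cosh (n * x)) + sinh x ^ 2) - (n + 4) * (log (cosh (n * x)) - (n + 2) * log (cosh x)))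
    (fun x => (((((Real.hasDerivAt_sinh x).mul (Real.hasDerivAt_cosh x)).mul 
      (((hl x).sinh).div ((hl x).cosh) (cosh_pos _).ne')).add ((Real.hasDerivAt_sinh x).pow 2)).const_mul (n * (n+1))).sub
      ((((hl x).cosh.log (cosh_pos _).ne').sub (((Real.hasDerivAt_cosh x).log (cosh_pos _).ne').const_mul (n+2))).const_mul (n+4))) (by simp) (by
      intro x hx
      have hs : 0 ≤ sinh x := sinh_nonneg_iff.2 hx.le
      have hS : 0 ≤ sinh (n*x) := sinh_nonneg_iff.2 (by positivity)
      have hb := sinh_bound n hn hx.le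
      have hc := cosh_pos x
      have hC := cosh_pos (n*x)
      have hc1 : 1 ≤ cosh x := one_le_cosh x
      have e1 := Real.cosh_sq x
      have e2 := Real.cosh_sq (n*x)
      simp only [Pi.mul_apply, Pi.div_apply]
      set s := sinh x
      set c := cosh x
      set S := sinh (n*x)
      set C := cosh (n*x)
      have hT : S / C ≤ (n+1) * (s / c) := by
        rw [div_le_iff₀ hC, ← mul_div_assoc, div_mul_eq_mul_div, le_div_iff₀ hc]; linarith
      have hT0 : 0 ≤ S / C := by positivity
      have ht0 : 0 ≤ s / c := by positivity
      have hsc : s / c ≤ s * c := by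
        rw [div_le_iff₀ hc]; nlinarith [mul_nonneg hs (sub_nonneg.2 hc1), mul_nonneg (mul_nonneg hs hc.le) (sub_nonneg.2 hc1)]
      have e3 : (C * n * C - S * (S * n)) / C^2 = n / C^2 := by
        congr 1; nlinarith
      have e4 : (C * n) * C - S * (S * n) = n := by nlinarith
      have hq : 0 ≤ s * c * (n / C^2) := by positivity
      have e5 : S * n / C = n * (S / C) := by ring
      have goal' : 0 ≤ n * (n+1) * ((c * c + s * s) * (S / C) + s * c * (n / C^2) + 2 * s * c)
         - (n+4) * (n * (S/C) - (n+2) * (s / c)) := by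
        have h1 : S / C ≤ (c * c + s * s) * (S / C) := by
          nlinarith [mul_nonneg hT0 (mul_nonneg hs hs)]
        have h2 : n * (n+1) * (S / C + 2 * (s / c)) ≤ n * (n+1) * ((c * c + s * s) * (S / C) + s * c * (n / C^2) + 2 * s * c) := by
          apply mul_le_mul_of_nonneg_left _ (by positivity)
          nlinarith
        have h3 : 3 * n * (S/C) ≤ 3 * n * ((n+1) * (s/c)) := by gcongr
        have h4 : 0 ≤ n * (s/c) := by positivity
        nlinarith
      convert goal' using 1
      have e6 : (S * n) * S = C*n*C - n := by linarith
      field_simp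
      simp only [Nat.cast_ofNat]
      grind) hx
  linarith [key]

lemma claim_norm (p : ℝ) (hp : 1 < p) {x : ℝ} (hx : 0 ≤ x) :
    cosh ((p-1) * x) / cosh x ≤
    (1 - (p-1)/(2*(p+1))) * (cosh x * (cosh ((p-1) * x) / cosh x) ^ (1 - 1/p))
      + (p-1)/(2*(p+1)) * cosh (p * x) := by
  have hD := D_nonneg (p-1) (by linarith) hx
  have hc := cosh_pos x
  have hC := cosh_pos ((p-1)*x)
  have hE : 0 < cosh ((p-1) * x) / cosh x := by positivity
  have hlE : log (cosh ((p-1) * x) / cosh x) = log (cosh ((p-1) * x)) - log (cosh x) :=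
    Real.log_div hC.ne' hc.ne'
  have h1 : cosh x * (cosh ((p-1) * x) / cosh x) ^ (1 - 1/p) =
      (cosh ((p-1) * x) / cosh x) *
      exp (log (cosh x) - (log (cosh ((p-1) * x)) - log (cosh x))/p) := by
    rw [Real.rpow_def_of_pos hE, ← hlE]
    calc _ = exp (log (cosh x)) * exp (log (cosh ((p-1) * x) / cosh x) * (1 - 1/p)) := by
          rw [exp_log hc]
      _ = exp (log (cosh ((p-1) * x) / cosh x)) *
          exp (log (cosh x) - log (cosh ((p-1) * x) / cosh x) / p) := by
          rw [← exp_add, ← exp_add]; congr 1; ring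
      _ = _ := by rw [exp_log hE]
  have h2 := Real.add_one_le_exp (log (cosh x) - (log (cosh ((p-1) * x)) - log (cosh x))/p)
  have h3 : cosh (p * x) = (cosh ((p-1) * x) / cosh x) * (1 +
      (sinh x * cosh x * (sinh ((p-1) * x) / cosh ((p-1) * x)) + sinh x ^ 2)) := by
    have : p * x = (p-1)*x + x := by ring
    rw [this, Real.cosh_add]
    have := Real.cosh_sq x
    field_simp
    grind
  rw [h1, h3]
  set E := cosh ((p-1) * x) / cosh x
  set Z := (sinh x * cosh x * (sinh ((p-1) * x) / cosh ((p-1) * x)) + sinh x ^ 2)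
  set L := log (cosh ((p-1) * x))
  set l := log (cosh x)
  have hg : 0 ≤ (1 - (p-1)/(2*(p+1))) := by
    rw [sub_nonneg, div_le_one (by linarith)]; linarith
  have key : 0 ≤ (1 - (p-1)/(2*(p+1))) * (l - (L - l)/p) + (p-1)/(2*(p+1)) * Z := by
    have : (1 - (p-1)/(2*(p+1))) * (l - (L - l)/p) + (p-1)/(2*(p+1)) * Z =
      ((p-1) * (p-1+1) * Z - (p-1+4) * (L - (p-1+2)*l)) / (2 * p * (p+1)) := by
      field_simp; ring
    rw [this]
    apply div_nonneg (by linarith) (by nlinarith)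
  have h4 := mul_le_mul_of_nonneg_left h2 hg
  have h5 : 1 ≤ (1 - (p-1)/(2*(p+1))) * exp (l - (L - l)/p) + (p-1)/(2*(p+1)) * (1+Z) := by
    linarith
  calc E = E * 1 := by ring
    _ ≤ E * _ := mul_le_mul_of_nonneg_left h5 hE.le
    _ = _ := by ring

lemma claim_gen (p : ℝ) (hp : 1 < p) {a b : ℝ} (ha : 0 < a) (hb : 0 < b) :
    2 * ((b * a^p + a * b^p)/(a+b)) ≤
    (1 - (p-1)/(2*(p+1))) * ((a+b) * ((b * a^p + a * b^p)/(a+b)) ^ (1 - 1/p))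
      + (p-1)/(2*(p+1)) * (a^p + b^p) := by
  wlog hab : a ≤ b generalizing a b
  · have := this hb ha (le_of_not_ge hab)
    rw [add_comm b a, add_comm (b^p), add_comm (a * b^p)] at this
    exact this
  set x := (log b - log a)/2 with hx
  set y := (log b + log a)/2 with hy
  have hx0 : 0 ≤ x := by
    have := Real.log_le_log ha hab
    rw [hx]; linarith
  have eb : b = exp y * exp x := by
    rw [← exp_add, hx, hy]; ring_nf; rw [exp_log hb]
  have ea : a = exp y * exp (-x) := by
    rw [← exp_add, hx, hy]; ring_nf; rw [exp_log ha]
  have ebp : b^p = exp (p*y) * exp (p*x) := by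
    rw [Real.rpow_def_of_pos hb, ← exp_add]; congr 1; rw [hx, hy]; ring
  have eap : a^p = exp (p*y) * exp (-(p*x)) := by
    rw [Real.rpow_def_of_pos ha, ← exp_add]; congr 1; rw [hx, hy]; ring
  have hsum : a + b = exp y * (2 * cosh x) := by
    rw [ea, eb, Real.cosh_eq]; ring
  have hP : a^p + b^p = exp (p*y) * (2 * cosh (p*x)) := by
    rw [eap, ebp, Real.cosh_eq]; ring
  have hEE : (b * a^p + a * b^p)/(a+b) = exp (p*y) * (cosh ((p-1)*x) / cosh x) := by
    have hc := cosh_pos x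
    have e1 : exp (p*x) * exp (-x) = exp ((p-1)*x) := by rw [← exp_add]; ring_nf
    have e2 : exp (-(p*x)) * exp x = exp (-((p-1)*x)) := by rw [← exp_add]; ring_nf
    have : b * a^p + a * b^p = exp y * exp (p * y) * (2 * cosh ((p-1)*x)) := by
      rw [eap, ebp, ea, eb, Real.cosh_eq ((p-1)*x), ← e1, ← e2]; ring
    rw [this, hsum]
    field_simp
  have hr : (exp (p*y) * (cosh ((p-1)*x) / cosh x))^(1 - 1/p) =
      exp (p*y) / exp y * (cosh ((p-1)*x) / cosh x)^(1 - 1/p) := by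
    rw [Real.mul_rpow (exp_pos _).le (by have := cosh_pos x; have := cosh_pos ((p-1)*x); positivity)]
    congr 1
    rw [← exp_mul, ← exp_sub]; congr 1; field_simp
  rw [hP, hEE, hr, hsum]
  have := claim_norm p hp hx0
  have h := mul_le_mul_of_nonneg_left this (mul_pos two_pos (exp_pos (p*y))).le
  have hy0 := exp_pos y
  calc _ = 2 * exp (p*y) * (cosh ((p-1)*x) / cosh x) := by ring
    _ ≤ _ := h
    _ = _ := by field_simp

lemma claim_P (p : ℝ) (hp : 1 < p) {a b : ℝ} (ha : 0 < a) (hb : 0 < b) :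
    2 * ((b * a^p + a * b^p)/(a+b)) ≤ a^p + b^p := by
  rw [← mul_div_assoc, div_le_iff₀ (by positivity)]
  have : 0 ≤ (a^p - b^p) * (a - b) := by
    rcases le_total a b with h | h
    · exact mul_nonneg_of_nonpos_of_nonpos (sub_nonpos.2 (Real.rpow_le_rpow ha.le h (by linarith))) (by linarith)
    · exact mul_nonneg (sub_nonneg.2 (Real.rpow_le_rpow hb.le h (by linarith))) (by linarith)
  nlinarith

noncomputable def KK (p : ℝ) : ℝ := ∫ t in (0:ℝ)..1, (1 - t^p)^(1 - 1/p)

lemma r_pos {p : ℝ} (hp : 1 < p) : 0 < 1 - 1/p := by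
  rw [sub_pos, div_lt_one (by linarith)]; exact hp

lemma cont_rpow {r : ℝ} (hr : 0 ≤ r) {f : ℝ → ℝ} (hf : Continuous f) :
    Continuous (fun x => f x ^ r) := hf.rpow_const (fun _ => Or.inr hr)

lemma cont_k {p : ℝ} (hp : 1 < p) : Continuous (fun t : ℝ => (1 - t^p)^(1 - 1/p)) :=
  cont_rpow (r_pos hp).le (continuous_const.sub (cont_rpow (by linarith) continuous_id))

lemma KK_le_one {p : ℝ} (hp : 1 < p) : KK p ≤ 1 := by
  have : KK p ≤ ∫ t in (0:ℝ)..1, (1:ℝ) := by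
    apply intervalIntegral.integral_mono_on (by norm_num) ((cont_k hp).intervalIntegrable _ _) (by simp)
    intro t ht
    have h1 : t^p ≤ 1 := Real.rpow_le_one ht.1 ht.2 (by linarith)
    have h2 : 0 ≤ t^p := Real.rpow_nonneg ht.1 _
    exact Real.rpow_le_one (by linarith) (by linarith) (r_pos hp).le
  simpa using this

lemma KK_pos {p : ℝ} (hp : 1 < p) : 0 < KK p := by
  apply intervalIntegral.integral_pos (by norm_num) (cont_k hp).continuousOn
  · intro t ht
    have h1 : t^p ≤ 1 := Real.rpow_le_one ht.1.le ht.2 (by linarith)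
    exact Real.rpow_nonneg (by linarith) _
  · refine ⟨0, by simp, ?_⟩
    rw [Real.zero_rpow (by linarith)]; simp

lemma half_int (p : ℝ) {b E l : ℝ} (hb : 0 < b) (hE : E = b^p + l * b) :
    ∫ s in (0:ℝ)..b, (E - |s|^p - l*s)^(1 - 1/p) =
      b * ∫ t in (0:ℝ)..1, ((1-t)*E + (t - t^p) * b^p)^(1 - 1/p) := by
  have := intervalIntegral.mul_integral_comp_mul_left (a := 0) (b := 1)
    (f := fun s : ℝ => (E - |s|^p - l*s)^(1 - 1/p)) b
  simp only [mul_zero, mul_one] at this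
  rw [← this]
  congr 1
  apply intervalIntegral.integral_congr
  intro t ht
  rw [Set.uIcc_of_le (by norm_num)] at ht
  simp only
  congr 1
  rw [abs_of_nonneg (mul_nonneg hb.le ht.1), Real.mul_rpow hb.le ht.1, hE]
  ring

lemma ptwise (p : ℝ) (hp : 1 < p) {b E t : ℝ} (hb : 0 < b) (hE : 0 < E) (ht : t ∈ Set.Icc (0:ℝ) 1) :
    ∃ z : ℝ, z = (t - t^p)/(1-t^p) * (1-t^p)^(1 - 1/p) ∧
    ((1 - t^p)^(1 - 1/p) - z) * E^(1 - 1/p) + z * b^(p-1) ≤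
      ((1-t)*E + (t - t^p) * b^p)^(1 - 1/p) := by
  refine ⟨_, rfl, ?_⟩
  have htp : t^p ≤ t := by
    simpa using Real.rpow_le_rpow_of_exponent_ge_of_imp ht.1 ht.2 hp.le (fun _ h => by linarith)
  rcases eq_or_lt_of_le ht.2 with h1 | h1
  · subst h1
    have := r_pos hp
    rw [Real.one_rpow, sub_self, Real.zero_rpow this.ne']; simp [Real.zero_rpow (by simpa using this.ne' : 1 - p⁻¹ ≠ 0)]
  have h0 : 0 < 1 - t^p := by linarith
  set g := (t - t^p)/(1-t^p) with hg
  have hg0 : 0 ≤ g := div_nonneg (by linarith) h0.le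
  have hg1 : 0 ≤ 1 - g := by
    rw [hg, sub_nonneg, div_le_one h0]; linarith
  have hbp : 0 < b^p := Real.rpow_pos_of_pos hb _
  have hconc := (Real.concaveOn_rpow (r_pos hp).le (by
    have : 0 < 1/p := by positivity
    linarith : 1 - 1/p ≤ 1)).2 (Set.mem_Ici.2 hE.le) (Set.mem_Ici.2 hbp.le) hg1 hg0 (by ring)
  simp only [smul_eq_mul] at hconc
  have e1 : (b^p)^(1-1/p) = b^(p-1) := by
    rw [← Real.rpow_mul hb.le]; congr 1; field_simp
  have e2 : (1-t)*E + (t - t^p) * b^p = (1 - t^p) * ((1-g)*E + g * b^p) := by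
    rw [hg]; field_simp; ring
  rw [e2, Real.mul_rpow h0.le (by positivity)]
  rw [e1] at hconc
  have hk : 0 ≤ (1 - t^p)^(1-1/p) := by positivity
  have := mul_le_mul_of_nonneg_left hconc hk
  linarith

lemma z_bounds (p : ℝ) (hp : 1 < p) {t : ℝ} (ht : t ∈ Set.Icc (0:ℝ) 1) :
    t - t^p ≤ (t - t^p)/(1-t^p) * (1-t^p)^(1 - 1/p) ∧
    (t - t^p)/(1-t^p) * (1-t^p)^(1 - 1/p) ≤ (1-t^p)^(1 - 1/p) := by
  have htp : t^p ≤ t := by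
    simpa using Real.rpow_le_rpow_of_exponent_ge_of_imp ht.1 ht.2 hp.le (fun _ h => by linarith)
  rcases eq_or_lt_of_le ht.2 with h1 | h1
  · subst h1
    have := r_pos hp
    rw [Real.one_rpow, sub_self, Real.zero_rpow this.ne']; simp [Real.zero_rpow (by simpa using this.ne' : 1 - p⁻¹ ≠ 0)]
  have h0 : 0 < 1 - t^p := by linarith
  have h2 : 0 ≤ t^p := Real.rpow_nonneg ht.1 _
  have hk : 0 ≤ (1 - t^p)^(1-1/p) := by positivity
  constructor
  · have : 1 - t^p ≤ (1-t^p)^(1-1/p) := by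
      have : 0 < 1/p := by positivity
      simpa using Real.rpow_le_rpow_of_exponent_ge h0 (by linarith) (by linarith : 1 - 1/p ≤ 1)
    rw [div_mul_eq_mul_div, le_div_iff₀ h0]
    exact mul_le_mul_of_nonneg_left this (by linarith)
  · have : (t - t^p)/(1-t^p) ≤ 1 := by rw [div_le_one h0]; linarith
    nlinarith

lemma int_t (p : ℝ) (hp : 1 < p) : ∫ t in (0:ℝ)..1, (t - t^p) = (p-1)/(2*(p+1)) := by
  rw [intervalIntegral.integral_sub (by simp) (intervalIntegral.intervalIntegrable_rpow' (by linarith)),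
    integral_rpow (Or.inl (by linarith)), integral_id, Real.one_rpow, Real.zero_rpow (by linarith)]
  have : p + 1 ≠ 0 := by linarith
  field_simp; ring

lemma main_int (p : ℝ) (hp : 1 < p) {a b E l : ℝ} (ha : 0 < a) (hb : 0 < b)
    (hE : E = (b * a^p + a * b^p)/(a+b)) (hl : l = (a^p - b^p)/(a+b)) :
    2 * E * KK p ≤ ∫ s in (-a)..b, (E - |s|^p - l*s)^(1 - 1/p) := by
  have hap := Real.rpow_pos_of_pos ha p
  have hbp := Real.rpow_pos_of_pos hb p
  have hE0 : 0 < E := by rw [hE]; positivity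
  have hEb : E = b^p + l * b := by rw [hE, hl]; field_simp; ring
  have hEa : E = a^p + (-l) * a := by rw [hE, hl]; field_simp; ring
  have hcont : Continuous (fun s : ℝ => (E - |s|^p - l*s)^(1 - 1/p)) :=
    cont_rpow (r_pos hp).le ((continuous_const.sub (cont_rpow (by linarith) continuous_abs)).sub
      (continuous_const.mul continuous_id))
  have hneg : ∫ s in (-a)..0, (E - |s|^p - l*s)^(1 - 1/p) =
      ∫ s in (0:ℝ)..a, (E - |s|^p - (-l)*s)^(1 - 1/p) := by
    have := intervalIntegral.integral_comp_neg (a := 0) (b := a) (fun s : ℝ => (E - |s|^p - l*s)^(1 - 1/p))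
    rw [neg_zero] at this
    rw [← this]
    simp
  rw [← intervalIntegral.integral_add_adjacent_intervals (hcont.intervalIntegrable _ 0)
    (hcont.intervalIntegrable _ _), hneg, half_int p ha hEa, half_int p hb hEb]
  have hcc : ∀ b : ℝ, Continuous (fun t : ℝ => ((1-t)*E + (t - t^p) * b^p)^(1 - 1/p)) := fun b =>
    cont_rpow (r_pos hp).le (((continuous_const.sub continuous_id).mul continuous_const).add
      ((continuous_id.sub (cont_rpow (by linarith) continuous_id)).mul continuous_const))
  have hci : ∀ b : ℝ, IntervalIntegrable (fun t : ℝ => b * ((1-t)*E + (t - t^p) * b^p)^(1 - 1/p)) volume 0 1 :=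
    fun b => (continuous_const.mul (hcc b)).intervalIntegrable _ _
  rw [← intervalIntegral.integral_const_mul, ← intervalIntegral.integral_const_mul,
    ← intervalIntegral.integral_add (hci a) (hci b)]
  set X := (a+b) * E^(1 - 1/p) with hX
  set Y := a^p + b^p with hY
  have hYE : 2 * E ≤ Y := by rw [hE]; exact claim_P p hp ha hb
  have hcl : 2 * E ≤ (1 - (p-1)/(2*(p+1))) * X + (p-1)/(2*(p+1)) * Y := by
    have := claim_gen p hp ha hb
    rw [← hE] at this
    exact this
  have hpw : ∀ t ∈ Set.Icc (0:ℝ) 1, ((1 - t^p)^(1 - 1/p) - (t - t^p)/(1-t^p) * (1-t^p)^(1 - 1/p)) * X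
      + (t - t^p)/(1-t^p) * (1-t^p)^(1 - 1/p) * Y ≤ a * ((1-t)*E + (t - t^p) * a^p)^(1 - 1/p)
      + b * ((1-t)*E + (t - t^p) * b^p)^(1 - 1/p) := by
    intro t ht
    obtain ⟨z, hz, h1⟩ := ptwise p hp ha hE0 ht
    obtain ⟨z', hz', h2⟩ := ptwise p hp hb hE0 ht
    rw [← hz'] at hz; subst hz
    rw [← hz']
    have h1 := mul_le_mul_of_nonneg_left h1 ha.le
    have h2 := mul_le_mul_of_nonneg_left h2 hb.le
    have e1 : a^p = a * a^(p-1) := by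
      rw [← Real.rpow_one_add' ha.le (by linarith)]; ring_nf
    have e2 : b^p = b * b^(p-1) := by
      rw [← Real.rpow_one_add' hb.le (by linarith)]; ring_nf
    calc _ = a * (((1 - t ^ p) ^ (1 - 1 / p) - z) * E ^ (1 - 1 / p) + z * a ^ (p - 1)) +
          b * (((1 - t ^ p) ^ (1 - 1 / p) - z) * E ^ (1 - 1 / p) + z * b ^ (p - 1)) := by
          rw [hX, hY, e1, e2]; ring
      _ ≤ _ := add_le_add h1 h2
  have hR : IntervalIntegrable (fun t : ℝ => a * ((1-t)*E + (t - t^p) * a^p)^(1 - 1/p)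
      + b * ((1-t)*E + (t - t^p) * b^p)^(1 - 1/p)) volume 0 1 :=
    (((continuous_const.mul (hcc a))).add (continuous_const.mul (hcc b))).intervalIntegrable _ _
  have hk0 : ∀ t ∈ Set.Icc (0:ℝ) 1, 0 ≤ (1 - t^p)^(1-1/p) := by
    intro t ht
    have h1 : t^p ≤ 1 := Real.rpow_le_one ht.1 ht.2 (by linarith)
    exact Real.rpow_nonneg (by linarith) _
  have hct : Continuous (fun t : ℝ => t - t^p) := (continuous_id.sub (cont_rpow (by linarith) continuous_id))
  by_cases hc : 2 * E ≤ X
  · rw [KK, ← intervalIntegral.integral_const_mul]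
    apply intervalIntegral.integral_mono_on (by norm_num) ((continuous_const.mul (cont_k hp)).intervalIntegrable _ _) hR
    intro t ht
    refine le_trans ?_ (hpw t ht)
    obtain ⟨b1, b2⟩ := z_bounds p hp ht
    have htp : t^p ≤ t := by
      simpa using Real.rpow_le_rpow_of_exponent_ge_of_imp ht.1 ht.2 hp.le (fun _ h => by linarith)
    simp only [Pi.mul_apply]
    nlinarith [mul_nonneg (sub_nonneg.2 b2) (sub_nonneg.2 hc), mul_nonneg ((sub_nonneg.2 htp).trans b1) (sub_nonneg.2 hYE)]
  · push Not at hc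
    have : ∫ t in (0:ℝ)..1, ((1 - t^p)^(1 - 1/p) * X + (t - t^p) * (Y - X)) ≤
        ∫ t in (0:ℝ)..1, (a * ((1-t)*E + (t - t^p) * a^p)^(1 - 1/p)
      + b * ((1-t)*E + (t - t^p) * b^p)^(1 - 1/p)) := by
      apply intervalIntegral.integral_mono_on (by norm_num) (((cont_k hp).mul continuous_const).add (hct.mul continuous_const) |>.intervalIntegrable _ _) hR
      intro t ht
      refine le_trans ?_ (hpw t ht)
      obtain ⟨b1, b2⟩ := z_bounds p hp ht
      simp only [Pi.mul_apply, Pi.add_apply]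
      nlinarith [mul_nonneg (sub_nonneg.2 b1) (by linarith : 0 ≤ Y - X)]
    refine le_trans ?_ this
    have i1 : IntervalIntegrable (fun t : ℝ => (1 - t^p)^(1 - 1/p) * X) volume 0 1 :=
      ((cont_k hp).mul continuous_const).intervalIntegrable _ _
    have i2 : IntervalIntegrable (fun t : ℝ => (t - t^p) * (Y - X)) volume 0 1 :=
      (hct.mul continuous_const).intervalIntegrable _ _
    rw [intervalIntegral.integral_add i1 i2, intervalIntegral.integral_mul_const,
      intervalIntegral.integral_mul_const, int_t p hp]
    change _ ≤ KK p * X + _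
    have hK1 := KK_le_one hp
    have hK0 := KK_pos hp
    have hg : 0 ≤ (p-1)/(2*(p+1)) := div_nonneg (by linarith) (by linarith)
    set γ := (p-1)/(2*(p+1))
    nlinarith [mul_nonneg hK0.le (sub_nonneg.2 hcl), mul_nonneg (mul_nonneg hg (by linarith : 0 ≤ Y - X)) (sub_nonneg.2 hK1)]

noncomputable def nu (p : ℝ) : ℝ := (2*p*KK p/((p-1)*π))^p

lemma nu_pos {p : ℝ} (hp : 1 < p) : 0 < nu p := by
  have := KK_pos hp
  have : 0 < p - 1 := by linarith
  have := pi_pos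
  unfold nu; positivity

lemma young_aux {p : ℝ} (hp : 1 < p) {A : ℝ} (hA : 0 ≤ A) (y : ℝ) :
    p * (A^(1-1/p) * |y|) ≤ |y|^p + (p-1) * A := by
  have h := Real.young_inequality_of_nonneg (abs_nonneg y) (Real.rpow_nonneg hA (1-1/p))
    (Real.HolderConjugate.conjExponent hp)
  have hp1 : p - 1 ≠ 0 := by linarith
  have e : (A^(1-1/p))^(p.conjExponent) = A := by
    rw [← Real.rpow_mul hA, Real.conjExponent]
    have : (1 - 1/p) * (p/(p-1)) = 1 := by field_simp
    rw [this, Real.rpow_one]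
  rw [e, Real.conjExponent] at h
  have hp0 : 0 < p := by linarith
  calc p * (A^(1-1/p) * |y|) = p * (|y| * A^(1-1/p)) := by ring
    _ ≤ p * (|y|^p/p + A/(p/(p-1))) := by gcongr
    _ = _ := by field_simp

lemma per_deriv {v : ℝ → ℝ} {T : ℝ} (h : Function.Periodic v T) : Function.Periodic (deriv v) T := by
  intro x
  rw [← deriv_comp_add_const]
  congr 1
  ext y; exact h y

lemma per_int {f : ℝ → ℝ} (h : Function.Periodic f (2*π)) (x : ℝ) :
    ∫ y in (0:ℝ)..(2*π), f y = ∫ y in x..(x+2*π), f y := by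
  have := h.intervalIntegral_add_eq 0 x
  rwa [zero_add] at this

lemma ne_int_pos {f : ℝ → ℝ} (h : Function.Periodic f (2*π)) (hc : Continuous f) (h0 : ∀ x, 0 ≤ f x)
    (hne : ∃ x, f x ≠ 0) : 0 < ∫ y in (0:ℝ)..(2*π), f y := by
  obtain ⟨x, hx⟩ := hne
  obtain ⟨y, hy, hxy⟩ := h.exists_mem_Ico₀ two_pi_pos x
  apply intervalIntegral.integral_pos two_pi_pos hc.continuousOn (fun x _ => h0 x)
  exact ⟨y, ⟨hy.1, hy.2.le⟩, lt_of_le_of_ne (h0 y) (by rw [← hxy]; exact hx.symm)⟩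

lemma lower (p : ℝ) (hp : 1 < p) {v : ℝ → ℝ} (hper : Function.Periodic v (2*π)) (hv : ContDiff ℝ 1 v)
    (h0 : ∫ x in (0:ℝ)..(2*π), v x = 0) :
    (p-1) * nu p * ∫ x in (0:ℝ)..(2*π), |v x|^p ≤ ∫ x in (0:ℝ)..(2*π), |deriv v x|^p := by
  have hp0 : 0 < p := by linarith
  have hvc := hv.continuous
  obtain ⟨hvd, hdc⟩ := contDiff_one_iff_deriv.1 hv
  by_cases hne : ∃ x, v x ≠ 0
  swap
  · push Not at hne
    have : v = 0 := funext hne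
    subst this
    simp [Real.zero_rpow hp0.ne']
  have h2 := two_pi_pos
  obtain ⟨xm, -, hxm⟩ := isCompact_Icc.exists_isMinOn (Set.nonempty_Icc.2 h2.le) (hvc.continuousOn (s := Set.Icc 0 (2*π)))
  obtain ⟨xM, -, hxM⟩ := isCompact_Icc.exists_isMaxOn (Set.nonempty_Icc.2 h2.le) (hvc.continuousOn (s := Set.Icc 0 (2*π)))
  have hmin : ∀ y, v xm ≤ v y := by
    intro y
    obtain ⟨z, hz, e⟩ := hper.exists_mem_Ico₀ h2 y
    rw [e]; exact hxm ⟨hz.1, hz.2.le⟩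
  have hmax : ∀ y, v y ≤ v xM := by
    intro y
    obtain ⟨z, hz, e⟩ := hper.exists_mem_Ico₀ h2 y
    rw [e]; exact hxM ⟨hz.1, hz.2.le⟩
  have hmneg : v xm < 0 := by
    by_contra hcon
    push Not at hcon
    have := ne_int_pos hper hvc (fun x => hcon.trans (hmin x)) hne
    linarith
  have hMpos : 0 < v xM := by
    by_contra hcon
    push Not at hcon
    have := ne_int_pos (f := fun x => - v x) (fun x => by simp [hper x]) hvc.neg (fun x => by linarith [hmax x])
      (by simpa using hne)
    rw [intervalIntegral.integral_neg] at this
    linarith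
  obtain ⟨xN, hxN, eN⟩ := hper.exists_mem_Ico h2 xM xm
  rw [eN] at hmax hMpos
  set a := - v xm with ha
  set b := v xN with hb
  have ha0 : 0 < a := by linarith
  set E := (b * a^p + a * b^p)/(a+b) with hE
  set l := (a^p - b^p)/(a+b) with hl
  have hap := Real.rpow_pos_of_pos ha0 p
  have hbp := Real.rpow_pos_of_pos hMpos p
  have hEb : E = b^p + l * b := by rw [hE, hl]; field_simp; ring
  have hEa : E = a^p + (-l) * a := by rw [hE, hl]; field_simp; ring
  have hE0 : 0 < E := by rw [hE]; positivity
  have hmain := main_int p hp ha0 hMpos hE hl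
  -- nonnegativity of f
  have hf0 : ∀ s, -a ≤ s → s ≤ b → 0 ≤ E - |s|^p - l * s := by
    intro s hs1 hs2
    rcases le_total 0 s with hs | hs
    · rw [abs_of_nonneg hs]
      obtain ⟨t, rfl⟩ : ∃ t, s = b * t := ⟨s / b, by field_simp⟩
      have ht0 : 0 ≤ t := by
        by_contra hh; push Not at hh; nlinarith
      have ht1 : t ≤ 1 := by
        by_contra hh; push Not at hh; nlinarith
      have htp : t^p ≤ t := by
        simpa using Real.rpow_le_rpow_of_exponent_ge_of_imp ht0 ht1 hp.le (fun _ h => by linarith)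
      rw [Real.mul_rpow hMpos.le ht0]
      have : E - b^p * t^p - l * (b*t) = (1-t)*E + (t - t^p) * b^p := by rw [hEb]; ring
      rw [this]
      have := mul_nonneg (sub_nonneg.2 ht1) hE0.le
      have := mul_nonneg (sub_nonneg.2 htp) hbp.le
      linarith
    · rw [abs_of_nonpos hs]
      obtain ⟨t, rfl⟩ : ∃ t, s = -(a * t) := ⟨-s / a, by field_simp⟩
      have ht0 : 0 ≤ t := by
        by_contra hh; push Not at hh; nlinarith
      have ht1 : t ≤ 1 := by
        by_contra hh; push Not at hh; nlinarith
      have htp : t^p ≤ t := by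
        simpa using Real.rpow_le_rpow_of_exponent_ge_of_imp ht0 ht1 hp.le (fun _ h => by linarith)
      rw [neg_neg, Real.mul_rpow ha0.le ht0]
      have : E - a^p * t^p - l * -(a*t) = (1-t)*E + (t - t^p) * a^p := by rw [hEa]; ring
      rw [this]
      have := mul_nonneg (sub_nonneg.2 ht1) hE0.le
      have := mul_nonneg (sub_nonneg.2 htp) hap.le
      linarith
  set f : ℝ → ℝ := fun s => E - |s|^p - l * s with hf
  have hfc : Continuous f := (continuous_const.sub (cont_rpow hp0.le continuous_abs)).sub
      (continuous_const.mul continuous_id)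
  set g : ℝ → ℝ := fun s => (f s)^(1-1/p) with hg
  have hgc : Continuous g := cont_rpow (r_pos hp).le hfc
  have hfv : ∀ x, 0 ≤ f (v x) := fun x => hf0 _ (by simp only [ha, neg_neg]; exact hmin x) (hmax x)
  have hgv : ∀ x, 0 ≤ g (v x) := fun x => Real.rpow_nonneg (hfv x) _
  have hJc : Continuous (fun x => g (v x) * |deriv v x|) := (hgc.comp hvc).mul hdc.abs
  have hsub : ∀ x y, ∫ t in x..y, g (v t) * deriv v t = ∫ s in (v x)..(v y), g s := by
    intro x y
    exact intervalIntegral.integral_comp_mul_deriv (fun t _ => (hvd t).hasDerivAt) hdc.continuousOn hgc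
  have hg1 : ∫ s in (-a)..b, g s ≤ ∫ t in xm..xN, g (v t) * |deriv v t| := by
    have : ∫ s in (-a)..b, g s = ∫ t in xm..xN, g (v t) * deriv v t := by
      rw [hsub]; simp [ha, hb]
    rw [this]
    apply intervalIntegral.integral_mono_on hxN.1 (((hgc.comp hvc).mul hdc).intervalIntegrable _ _) (hJc.intervalIntegrable _ _)
    intro t _
    exact mul_le_mul_of_nonneg_left (le_abs_self _) (hgv t)
  have hg2 : ∫ s in (-a)..b, g s ≤ ∫ t in xN..(xm+2*π), g (v t) * |deriv v t| := by
    have : ∫ s in (-a)..b, g s = ∫ t in xN..(xm+2*π), -(g (v t) * deriv v t) := by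
      rw [intervalIntegral.integral_neg, hsub, hper xm, ← intervalIntegral.integral_symm]; simp [ha, hb]
    rw [this]
    apply intervalIntegral.integral_mono_on hxN.2.le (((hgc.comp hvc).mul hdc).neg.intervalIntegrable _ _) (hJc.intervalIntegrable _ _)
    intro t _
    have := mul_le_mul_of_nonneg_left (neg_le_abs (deriv v t)) (hgv t)
    simp only [Pi.mul_apply, Pi.neg_apply, Function.comp] at *
    linarith
  have hg3 : 2 * (2 * E * KK p) ≤ ∫ t in xm..(xm+2*π), g (v t) * |deriv v t| := by
    rw [← intervalIntegral.integral_add_adjacent_intervals (hJc.intervalIntegrable xm xN) (hJc.intervalIntegrable _ _)]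
    linarith
  have hν := nu_pos hp
  set ν := nu p with hνd
  have hvp : Continuous (fun x => |v x|^p) := cont_rpow hp0.le hvc.abs
  have hdp : Continuous (fun x => |deriv v x|^p) := cont_rpow hp0.le hdc.abs
  have hint : ∫ t in xm..(xm+2*π), (p * ν^(1-1/p)) * (g (v t) * |deriv v t|) ≤
      ∫ t in xm..(xm+2*π), (|deriv v t|^p + (p-1) * ν * f (v t)) := by
    have c1 : Continuous (fun t => (p * ν^(1-1/p)) * (g (v t) * |deriv v t|)) := continuous_const.mul hJc
    have c2 : Continuous (fun t => (|deriv v t|^p + (p-1) * ν * f (v t))) := hdp.add (continuous_const.mul (hfc.comp hvc))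
    apply intervalIntegral.integral_mono_on (by linarith) (c1.intervalIntegrable _ _) (c2.intervalIntegrable _ _)
    intro t _
    have := young_aux hp (mul_nonneg hν.le (hfv t)) (deriv v t)
    rw [Real.mul_rpow hν.le (hfv t)] at this
    simp only [hg]
    linarith
  rw [intervalIntegral.integral_const_mul] at hint
  have hper1 : Function.Periodic (fun x => |v x|^p) (2*π) := fun x => by simp only [hper x]
  have hper2 : Function.Periodic (fun x => |deriv v x|^p) (2*π) := fun x => by simp only [per_deriv hper x]
  have i1 : IntervalIntegrable (fun x => |v x|^p) volume xm (xm+2*π) := hvp.intervalIntegrable _ _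
  have i2 : IntervalIntegrable (fun x => |deriv v x|^p) volume xm (xm+2*π) := hdp.intervalIntegrable _ _
  have i3 : IntervalIntegrable (fun x => (p-1) * ν * f (v x)) volume xm (xm+2*π) :=
    (continuous_const.mul (hfc.comp hvc)).intervalIntegrable _ _
  have i4 : IntervalIntegrable (fun x => l * v x) volume xm (xm+2*π) :=
    (continuous_const.mul hvc).intervalIntegrable _ _
  have i5 : IntervalIntegrable (fun x => E - |v x|^p) volume xm (xm+2*π) :=
    (continuous_const.sub hvp).intervalIntegrable _ _
  have hfint : ∫ t in xm..(xm+2*π), f (v t) = 2*π*E - ∫ x in (0:ℝ)..(2*π), |v x|^p := by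
    simp only [hf]
    rw [intervalIntegral.integral_sub i5 i4, intervalIntegral.integral_sub (by simp) i1,
      intervalIntegral.integral_const_mul, ← per_int hper, h0, per_int hper1 xm]
    simp
  rw [intervalIntegral.integral_add i2 i3, intervalIntegral.integral_const_mul, hfint, ← per_int hper2] at hint
  have hνr : ν = ν^(1-1/p) * (2*p*KK p/((p-1)*π)) := by
    have hb : 0 ≤ 2*p*KK p/((p-1)*π) := by
      have := KK_pos hp
      have : 0 < p - 1 := by linarith
      have := pi_pos
      positivity
    have : (2*p*KK p/((p-1)*π)) = ν^(1/p) := by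
      rw [hνd, nu, ← Real.rpow_mul hb, mul_one_div_cancel hp0.ne', Real.rpow_one]
    rw [this, ← Real.rpow_add hν]; simp
  have hνr' : (p-1) * ν * (2*π*E) = (p * ν^(1-1/p)) * (2 * (2 * E * KK p)) := by
    have : p - 1 ≠ 0 := by linarith
    have := pi_pos
    nth_rewrite 1 [hνr]
    field_simp
  have := mul_le_mul_of_nonneg_left hg3 (by positivity : 0 ≤ p * ν^(1-1/p))
  nlinarith

lemma testA (p : ℝ) {w : ℝ → ℝ} (hw : Continuous w) (hpos : ∀ x, 0 < w x)
    (hper : Function.Periodic w π) (hI : ∫ x in (0:ℝ)..π, w x = π) :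
    ∃ u : ℝ → ℝ, ContDiff ℝ 1 u ∧ (∀ x, u (x+π) = - u x) ∧ u ≠ 0 ∧
      ((0:ℝ) ≤ p → ∫ x in (0:ℝ)..(2*π), |u x|^p = ∫ x in (0:ℝ)..(2*π), |sin x|^p * w x) ∧
      ((0:ℝ) ≤ p → ∫ x in (0:ℝ)..(2*π), |deriv u x|^p = ∫ x in (0:ℝ)..(2*π), |cos x|^p * (w x)^(1-p)) := by
  set X : ℝ → ℝ := fun y => ∫ x in (0:ℝ)..y, w x with hX
  have hXd : ∀ y, HasDerivAt X (w y) y := fun y =>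
    intervalIntegral.integral_hasDerivAt_right (hw.intervalIntegrable _ _)
      (hw.stronglyMeasurableAtFilter _ _) hw.continuousAt
  have hXc : Continuous X := continuous_iff_continuousAt.2 (fun y => (hXd y).continuousAt)
  have hXm : StrictMono X := strictMono_of_deriv_pos (fun y => by rw [(hXd y).deriv]; exact hpos y)
  have hX0 : X 0 = 0 := by simp [hX]
  have hXp : ∀ y, X (y + π) = X y + π := by
    intro y
    have h1 := hper.intervalIntegral_add_eq y 0
    rw [zero_add, hI] at h1
    simp only [hX]
    rw [← intervalIntegral.integral_add_adjacent_intervals (hw.intervalIntegrable 0 y) (hw.intervalIntegrable _ _), h1]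
  have hXper : Function.Periodic (fun y => X y - y) π := fun y => by simp only [hXp y]; ring
  have hXn : ∀ n : ℤ, X (n * π) = n * π := by
    intro n
    have := hXper.int_mul n 0
    simp only [hX0, zero_add] at this
    linarith
  have hsurj : Function.Surjective X := by
    intro c
    refine mem_range_of_exists_le_of_exists_ge hXc ⟨(⌊c/π⌋ : ℤ) * π, ?_⟩ ⟨((⌊c/π⌋ + 1 : ℤ) : ℝ) * π, ?_⟩
    · rw [hXn, ← le_div_iff₀ pi_pos]; exact Int.floor_le _
    · rw [hXn, ← div_le_iff₀ pi_pos]; push_cast; exact (Int.lt_floor_add_one _).le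
  set e := hXm.orderIsoOfSurjective X hsurj with he
  have heX : ∀ y, e y = X y := fun y => rfl
  set T : ℝ → ℝ := fun x => e.symm x with hT
  have hTX : ∀ y, T (X y) = y := fun y => e.symm_apply_apply y
  have hXT : ∀ y, X (T y) = y := fun y => e.apply_symm_apply y
  have hTc : Continuous T := e.symm.continuous
  have hTd : ∀ x, HasDerivAt T (w (T x))⁻¹ x := fun x =>
    HasDerivAt.of_local_left_inverse hTc.continuousAt (hXd (T x)) (hpos _).ne'
      (Filter.Eventually.of_forall hXT)
  have hTp : ∀ x, T (x + π) = T x + π := by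
    intro x
    apply hXm.injective
    rw [hXT, hXp, hXT]
  have hud : ∀ x, HasDerivAt (fun x => sin (T x)) (cos (T x) * (w (T x))⁻¹) x := fun x => (hTd x).sin
  have hdu : deriv (fun x => sin (T x)) = fun x => cos (T x) * (w (T x))⁻¹ := funext fun x => (hud x).deriv
  have hduc : Continuous (fun x => cos (T x) * (w (T x))⁻¹) :=
    (continuous_cos.comp hTc).mul ((hw.comp hTc).inv₀ (fun x => (hpos _).ne'))
  have hX2 : X (2*π) = 2*π := by simpa using hXn 2
  have hcv : ∀ g : ℝ → ℝ, Continuous g → ∫ x in (0:ℝ)..(2*π), g x = ∫ y in (0:ℝ)..(2*π), g (X y) * w y := by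
    intro g hg
    have := intervalIntegral.integral_comp_mul_deriv (a := 0) (b := 2*π) (fun t _ => hXd t) hw.continuousOn hg
    rw [hX0, hX2] at this
    exact this.symm
  refine ⟨fun x => sin (T x), contDiff_one_iff_deriv.2 ⟨fun x => (hud x).differentiableAt, ?_⟩, ?_, ?_, ?_, ?_⟩
  · rw [hdu]; exact hduc
  · intro x
    simp only [hTp, sin_add_pi]
  · intro h
    have := congrFun h (X (π/2))
    simp [hTX] at this
  · intro hp
    rw [hcv (fun x => |sin (T x)|^p) (cont_rpow hp (continuous_sin.comp hTc).abs)]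
    simp only [hTX]
  · intro hp
    rw [hdu, hcv (fun x => |cos (T x) * (w (T x))⁻¹|^p) (cont_rpow hp hduc.abs)]
    simp only [hTX]
    congr 1
    ext y
    rw [abs_mul, abs_of_pos (inv_pos.2 (hpos y)), Real.mul_rpow (abs_nonneg _) (inv_pos.2 (hpos y)).le,
      Real.rpow_sub (hpos y), Real.rpow_one, Real.inv_rpow (hpos y).le]
    ring

lemma quarter {f : ℝ → ℝ} (hf : Continuous f) (hev : ∀ x, f (π - x) = f x) :
    ∫ x in (0:ℝ)..π, f x = 2 * ∫ x in (0:ℝ)..(π/2), f x := by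
  have h1 : ∫ x in (π/2)..π, f x = ∫ x in (0:ℝ)..(π/2), f x := by
    have := intervalIntegral.integral_comp_sub_left (a := 0) (b := π/2) f π
    simp only [hev, sub_zero] at this
    rw [this]; congr 1; ring
  rw [← intervalIntegral.integral_add_adjacent_intervals (hf.intervalIntegrable 0 (π/2)) (hf.intervalIntegrable _ _), h1]
  ring

lemma quarter2 {f : ℝ → ℝ} (hf : Continuous f) (hper : Function.Periodic f π) (hev : ∀ x, f (π - x) = f x) :
    ∫ x in (0:ℝ)..(2*π), f x = 4 * ∫ x in (0:ℝ)..(π/2), f x := by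
  have h1 := hper.intervalIntegral_add_eq π 0
  rw [zero_add, ← two_mul] at h1
  rw [← intervalIntegral.integral_add_adjacent_intervals (hf.intervalIntegrable 0 π) (hf.intervalIntegrable _ _), h1,
    quarter hf hev]
  ring

lemma sc_pos {x : ℝ} (hx : x ∈ Set.Ioo (0:ℝ) (π/2)) :
    0 < sin x ∧ sin x < 1 ∧ 0 < cos x := by
  have h1 : 0 < sin x := sin_pos_of_pos_of_lt_pi hx.1 (by linarith [hx.2, pi_pos])
  have h2 : 0 < cos x := cos_pos_of_mem_Ioo ⟨by linarith [hx.1, pi_pos], hx.2⟩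
  refine ⟨h1, ?_, h2⟩
  nlinarith [sin_sq_add_cos_sq x]

lemma h_pos {p x : ℝ} (hp : 1 < p) (hx : x ∈ Set.Ioo (0:ℝ) (π/2)) :
    1 - sin x ≤ 1 - sin x ^ p ∧ 0 < 1 - sin x ^ p := by
  obtain ⟨h1, h2, h3⟩ := sc_pos hx
  have : sin x ^ p ≤ sin x := by
    simpa using Real.rpow_le_rpow_of_exponent_ge h1 h2.le hp.le
  constructor <;> linarith

lemma ae_ioo : ∀ᵐ x : ℝ, x ∈ Set.uIoc (0:ℝ) (π/2) → x ∈ Set.Ioo (0:ℝ) (π/2) := by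
  have : ∀ᵐ x : ℝ, x ∉ ({π/2} : Set ℝ) := (Set.countable_singleton (π/2)).ae_notMem _
  filter_upwards [this] with x hx hx2
  rw [Set.uIoc_of_le (by positivity)] at hx2
  exact ⟨hx2.1, lt_of_le_of_ne hx2.2 hx⟩

lemma w_int (p : ℝ) (hp : 1 < p) :
    IntervalIntegrable (fun x => cos x * (1 - sin x ^ p)^(-(1/p))) volume 0 (π/2) := by
  have hr := r_pos hp
  have h1 : IntervalIntegrable (fun x => cos x * (1 - sin x)^(-(1/p))) volume 0 (π/2) := by
    rw [intervalIntegrable_iff_integrableOn_Ioc_of_le (by positivity)]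
    apply intervalIntegral.integrableOn_deriv_of_nonneg (g := fun x => -((1 - sin x)^(1-1/p) / (1-1/p)))
    · exact ((cont_rpow hr.le (continuous_const.sub continuous_sin)).div_const _).neg.continuousOn
    · intro x hx
      obtain ⟨h1, h2, h3⟩ := sc_pos hx
      have := ((((hasDerivAt_sin x).const_sub 1).rpow_const (p := 1 - 1/p) (Or.inl (by linarith))).div_const (1-1/p)).neg
      refine HasDerivAt.congr_deriv this ?_
      have e : 1 - 1/p - 1 = -(1/p) := by ring
      rw [e]
      have hpp : p - 1 ≠ 0 := by linarith
      field_simp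
    · intro x hx
      obtain ⟨h1, h2, h3⟩ := sc_pos hx
      exact mul_nonneg h3.le (Real.rpow_nonneg (by linarith) _)
  apply h1.mono_fun
  · apply Measurable.aestronglyMeasurable
    fun_prop
  · have := (ae_restrict_iff' (μ := volume) (s := Set.uIoc (0:ℝ) (π/2)) measurableSet_uIoc
      (p := fun x => ‖cos x * (1 - sin x ^ p)^(-(1/p))‖ ≤ ‖cos x * (1 - sin x)^(-(1/p))‖)).2 (by
      filter_upwards [ae_ioo] with x hx hx2
      have hx := hx hx2
      obtain ⟨h1, h2, h3⟩ := sc_pos hx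
      obtain ⟨h4, h5⟩ := h_pos hp hx
      rw [Real.norm_of_nonneg (mul_nonneg h3.le (Real.rpow_nonneg h5.le _)),
        Real.norm_of_nonneg (mul_nonneg h3.le (Real.rpow_nonneg (by linarith) _))]
      apply mul_le_mul_of_nonneg_left _ h3.le
      exact Real.rpow_le_rpow_of_nonpos (by linarith) h4 (by have : 0 < 1/p := by positivity
                                                             linarith))
    exact this

lemma N_eq_KK (p : ℝ) (hp : 1 < p) :
    ∫ x in (0:ℝ)..(π/2), cos x * (1 - sin x ^ p)^(1-1/p) = KK p := by
  have := intervalIntegral.integral_comp_mul_deriv (a := 0) (b := π/2) (fun x _ => hasDerivAt_sin x)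
    continuous_cos.continuousOn (cont_k hp)
  simp only [sin_zero, sin_pi_div_two, Function.comp] at this
  rw [KK, ← this]
  congr 1; ext x; ring

lemma sw_int (p : ℝ) (hp : 1 < p) :
    IntervalIntegrable (fun x => sin x ^ p * (cos x * (1 - sin x ^ p)^(-(1/p)))) volume 0 (π/2) :=
  (w_int p hp).continuousOn_mul (cont_rpow (by linarith) continuous_sin).continuousOn

lemma C_eq (p : ℝ) (hp : 1 < p) :
    ∫ x in (0:ℝ)..(π/2), sin x ^ p * (cos x * (1 - sin x ^ p)^(-(1/p))) = KK p / (p-1) := by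
  have hr := r_pos hp
  have ci : IntervalIntegrable (fun x => cos x * (1 - sin x ^ p)^(1-1/p)) volume 0 (π/2) :=
    (continuous_cos.mul ((cont_k hp).comp continuous_sin)).intervalIntegrable _ _
  have i2 := (sw_int p hp).const_mul (p-1)
  have key := intervalIntegral.integral_eq_sub_of_hasDerivAt_of_le (a := 0) (b := π/2) (by positivity)
    (f := fun x => sin x * (1 - sin x ^ p)^(1-1/p))
    (f' := fun x => cos x * (1 - sin x ^ p)^(1-1/p) - (p-1) * (sin x ^ p * (cos x * (1 - sin x ^ p)^(-(1/p)))))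
    ((continuous_sin.mul ((cont_k hp).comp continuous_sin)).continuousOn) (by
      intro x hx
      obtain ⟨h1, h2, h3⟩ := sc_pos hx
      obtain ⟨h4, h5⟩ := h_pos hp hx
      have d := (hasDerivAt_sin x).mul (((((hasDerivAt_sin x).rpow_const (p := p) (Or.inl h1.ne')).const_sub 1).rpow_const (p := 1 - 1/p) (Or.inl h5.ne')))
      refine HasDerivAt.congr_deriv d ?_
      have e : 1 - 1/p - 1 = -(1/p) := by ring
      have e2 : sin x ^ p = sin x * sin x ^ (p-1) := by
        rw [← Real.rpow_one_add' h1.le (by linarith)]; ring_nf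
      rw [e]
      have e3 : p * (1 - 1/p) = p - 1 := by field_simp
      generalize (1 - sin x ^ p)^(1-1/p) = A
      generalize (1 - sin x ^ p)^(-(1/p)) = B
      rw [e2, ← e3]; ring) (ci.sub i2)
  rw [intervalIntegral.integral_sub ci i2, intervalIntegral.integral_const_mul, N_eq_KK p hp] at key
  simp only [sin_pi_div_two, sin_zero, Real.one_rpow, sub_self, Real.zero_rpow hr.ne', mul_zero, zero_mul] at key
  rw [eq_div_iff (by linarith)]
  linarith

lemma B_eq (p : ℝ) (hp : 1 < p) :
    ∫ x in (0:ℝ)..(π/2), (cos x * (1 - sin x ^ p)^(-(1/p))) = p * KK p / (p-1) := by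
  have ci : IntervalIntegrable (fun x => cos x * (1 - sin x ^ p)^(1-1/p)) volume 0 (π/2) :=
    (continuous_cos.mul ((cont_k hp).comp continuous_sin)).intervalIntegrable _ _
  have : ∫ x in (0:ℝ)..(π/2), (cos x * (1 - sin x ^ p)^(-(1/p))) =
      ∫ x in (0:ℝ)..(π/2), (cos x * (1 - sin x ^ p)^(1-1/p) + sin x ^ p * (cos x * (1 - sin x ^ p)^(-(1/p)))) := by
    apply intervalIntegral.integral_congr_ae
    filter_upwards [ae_ioo] with x hx hx2
    obtain ⟨h4, h5⟩ := h_pos hp (hx hx2)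
    have : (1 - sin x ^ p)^(1-1/p) = (1 - sin x ^ p) * (1 - sin x ^ p)^(-(1/p)) := by
      rw [sub_eq_add_neg 1 (1/p), Real.rpow_add h5, Real.rpow_one]
    rw [this]; ring
  rw [this, intervalIntegral.integral_add ci (sw_int p hp), N_eq_KK p hp, C_eq p hp]
  have : p - 1 ≠ 0 := by linarith
  field_simp; ring

noncomputable def HH (p x : ℝ) : ℝ := (1 - |sin x|^p)^(1/p)

noncomputable def we (p ε x : ℝ) : ℝ := (|cos x| + ε) / (HH p x + ε)

lemma sin_abs_rpow_le {p : ℝ} (hp : 1 < p) (x : ℝ) : 0 ≤ 1 - |sin x|^p := by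
  have := Real.rpow_le_one (abs_nonneg (sin x)) (abs_sin_le_one x) (by linarith : 0 ≤ p)
  linarith

lemma HH_nonneg {p : ℝ} (hp : 1 < p) (x : ℝ) : 0 ≤ HH p x := Real.rpow_nonneg (sin_abs_rpow_le hp x) _

lemma HH_le_one {p : ℝ} (hp : 1 < p) (x : ℝ) : HH p x ≤ 1 := by
  apply Real.rpow_le_one (sin_abs_rpow_le hp x) _ (by positivity)
  have := Real.rpow_nonneg (abs_nonneg (sin x)) p
  linarith

lemma HH_cont {p : ℝ} (hp : 1 < p) : Continuous (HH p) :=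
  cont_rpow (by positivity) (continuous_const.sub (cont_rpow (by linarith) continuous_sin.abs))

lemma we_cont {p ε : ℝ} (hp : 1 < p) (hε : 0 < ε) : Continuous (we p ε) :=
  (continuous_cos.abs.add continuous_const).div ((HH_cont hp).add continuous_const)
    (fun x => by have := HH_nonneg hp x; positivity)

lemma we_pos {p ε : ℝ} (hp : 1 < p) (hε : 0 < ε) (x : ℝ) : 0 < we p ε x := by
  have := HH_nonneg hp x
  unfold we; positivity

lemma we_per (p ε : ℝ) : Function.Periodic (we p ε) π := by
  intro x; simp [we, HH, sin_add_pi, cos_add_pi]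

lemma we_ev (p ε x : ℝ) : we p ε (π - x) = we p ε x := by
  simp [we, HH, sin_pi_sub, cos_pi_sub]

open Filter Topology in
lemma we_tendsto {p x : ℝ} (hp : 1 < p) (hx : x ∈ Set.Ioo (0:ℝ) (π/2)) :
    Tendsto (fun ε => we p ε x) (𝓝[>] 0) (𝓝 (cos x * (1 - sin x ^ p)^(-(1/p)))) := by
  obtain ⟨h1, h2, h3⟩ := sc_pos hx
  obtain ⟨h4, h5⟩ := h_pos hp hx
  have hH : HH p x = (1 - sin x ^ p)^(1/p) := by rw [HH, abs_of_pos h1]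
  have hH0 : 0 < HH p x := by rw [hH]; positivity
  have : cos x * (1 - sin x ^ p)^(-(1/p)) = (|cos x| + 0) / (HH p x + 0) := by
    rw [abs_of_pos h3, hH, Real.rpow_neg h5.le]; simp [div_eq_mul_inv]
  rw [this]
  have hid : Tendsto (fun ε : ℝ => ε) (𝓝[>] 0) (𝓝 0) := tendsto_nhdsWithin_of_tendsto_nhds tendsto_id
  exact (tendsto_const_nhds.add hid).div (tendsto_const_nhds.add hid) (by simpa using hH0.ne')

lemma we_le {p x ε : ℝ} (hp : 1 < p) (hε : 0 < ε) (hx : x ∈ Set.Ioo (0:ℝ) (π/2)) :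
    we p ε x ≤ cos x * (1 - sin x ^ p)^(-(1/p)) + 1 := by
  obtain ⟨h1, h2, h3⟩ := sc_pos hx
  obtain ⟨h4, h5⟩ := h_pos hp hx
  have hH : HH p x = (1 - sin x ^ p)^(1/p) := by rw [HH, abs_of_pos h1]
  have hH0 : 0 < HH p x := by rw [hH]; positivity
  have : cos x * (1 - sin x ^ p)^(-(1/p)) = cos x / HH p x := by
    rw [hH, Real.rpow_neg h5.le]; simp [div_eq_mul_inv]
  rw [this, we, abs_of_pos h3, add_div]
  apply add_le_add
  · gcongr; linarith
  · rw [div_le_one (by positivity)]; linarith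

open Filter Topology in
lemma W_tendsto (p : ℝ) (hp : 1 < p) :
    Tendsto (fun ε => ∫ x in (0:ℝ)..(π/2), we p ε x) (𝓝[>] 0) (𝓝 (p * KK p / (p-1))) := by
  rw [← B_eq p hp]
  apply intervalIntegral.tendsto_integral_filter_of_dominated_convergence
    (fun x => cos x * (1 - sin x ^ p)^(-(1/p)) + 1)
  · filter_upwards [self_mem_nhdsWithin] with ε hε
    exact (we_cont hp hε).aestronglyMeasurable
  · filter_upwards [self_mem_nhdsWithin] with ε hε
    filter_upwards [ae_ioo] with x hx hx2
    rw [Real.norm_of_nonneg (we_pos hp hε x).le]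
    exact we_le hp hε (hx hx2)
  · exact (w_int p hp).add (by simp)
  · filter_upwards [ae_ioo] with x hx hx2
    exact we_tendsto hp (hx hx2)

open Filter Topology in
lemma S_tendsto (p : ℝ) (hp : 1 < p) :
    Tendsto (fun ε => ∫ x in (0:ℝ)..(π/2), |sin x|^p * we p ε x) (𝓝[>] 0) (𝓝 (KK p / (p-1))) := by
  rw [← C_eq p hp]
  apply intervalIntegral.tendsto_integral_filter_of_dominated_convergence
    (fun x => cos x * (1 - sin x ^ p)^(-(1/p)) + 1)
  · filter_upwards [self_mem_nhdsWithin] with ε hε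
    exact ((cont_rpow (by linarith) continuous_sin.abs).mul (we_cont hp hε)).aestronglyMeasurable
  · filter_upwards [self_mem_nhdsWithin] with ε hε
    filter_upwards [ae_ioo] with x hx hx2
    have h0 := (we_pos hp hε x).le
    have hs := Real.rpow_nonneg (abs_nonneg (sin x)) p
    have hs1 := sin_abs_rpow_le hp x
    rw [Real.norm_of_nonneg (mul_nonneg hs h0)]
    refine le_trans ?_ (we_le hp hε (hx hx2))
    nlinarith
  · exact (w_int p hp).add (by simp)
  · filter_upwards [ae_ioo] with x hx hx2
    have := we_tendsto hp (hx hx2)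
    obtain ⟨h1, h2, h3⟩ := sc_pos (hx hx2)
    rw [abs_of_pos h1]
    exact this.const_mul _

open Filter Topology in
lemma N_tendsto (p : ℝ) (hp : 1 < p) :
    Tendsto (fun ε => ∫ x in (0:ℝ)..(π/2), |cos x|^p * (we p ε x)^(1-p)) (𝓝[>] 0) (𝓝 (KK p)) := by
  rw [← N_eq_KK p hp]
  apply intervalIntegral.tendsto_integral_filter_of_dominated_convergence
    (fun x => (2:ℝ)^(p-1))
  · filter_upwards [self_mem_nhdsWithin] with ε hε
    exact ((cont_rpow (by linarith) continuous_cos.abs).mul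
      ((we_cont hp hε).rpow_const (fun x => Or.inl (we_pos hp hε x).ne'))).aestronglyMeasurable
  · have : ∀ᶠ ε : ℝ in 𝓝[>] 0, ε < 1 := nhdsWithin_le_nhds (gt_mem_nhds one_pos)
    filter_upwards [self_mem_nhdsWithin, this] with ε hε hε1
    rw [Set.mem_Ioi] at hε
    filter_upwards [ae_ioo] with x hx hx2
    obtain ⟨h1, h2, h3⟩ := sc_pos (hx hx2)
    have h0 := (we_pos hp hε x)
    rw [Real.norm_of_nonneg (mul_nonneg (Real.rpow_nonneg (abs_nonneg _) _) (Real.rpow_nonneg h0.le _))]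
    have hlow : cos x / 2 ≤ we p ε x := by
      unfold we
      rw [abs_of_pos h3]
      have := HH_le_one hp x
      have := HH_nonneg hp x
      apply div_le_div₀ <;> linarith
    calc |cos x|^p * (we p ε x)^(1-p) ≤ |cos x|^p * (cos x / 2)^(1-p) := by
          apply mul_le_mul_of_nonneg_left _ (Real.rpow_nonneg (abs_nonneg _) _)
          exact Real.rpow_le_rpow_of_nonpos (by positivity) hlow (by linarith)
      _ = cos x * 2^(p-1) := by
          rw [abs_of_pos h3, Real.div_rpow h3.le (by norm_num), ← mul_div_assoc, ← Real.rpow_add h3, div_eq_mul_inv,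
            ← Real.rpow_neg (by norm_num)]
          have e1 : p + (1 - p) = 1 := by ring
          have e2 : -(1-p) = p - 1 := by ring
          rw [e1, e2, Real.rpow_one]
      _ ≤ 2^(p-1) := by
          have : (0:ℝ) < 2^(p-1) := by positivity
          nlinarith [cos_le_one x]
  · simp
  · filter_upwards [ae_ioo] with x hx hx2
    have ht := we_tendsto hp (hx hx2)
    obtain ⟨h1, h2, h3⟩ := sc_pos (hx hx2)
    obtain ⟨h4, h5⟩ := h_pos hp (hx hx2)
    have hne : cos x * (1 - sin x ^ p)^(-(1/p)) ≠ 0 := by positivity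
    have := (ht.rpow_const (p := 1-p) (Or.inl hne)).const_mul (|cos x|^p)
    convert this using 2
    rw [abs_of_pos h3, Real.mul_rpow h3.le (by positivity), ← mul_assoc, ← Real.rpow_add h3, ← Real.rpow_mul h5.le]
    have e1 : p + (1 - p) = 1 := by ring
    have e2 : -(1/p) * (1-p) = 1 - 1/p := by field_simp; ring
    rw [e1, e2, Real.rpow_one]

open Filter Topology in
lemma test_exists (p : ℝ) (hp : 1 < p) {δ : ℝ} (hδ : (p-1) * nu p < δ) :
    ∃ u : ℝ → ℝ, ContDiff ℝ 1 u ∧ (∀ x, u (x+π) = - u x) ∧ u ≠ 0 ∧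
      (∫ x in (0:ℝ)..(2*π), |deriv u x|^p) / (∫ x in (0:ℝ)..(2*π), |u x|^p) < δ := by
  have hK := KK_pos hp
  have hp1 : 0 < p - 1 := by linarith
  have hπ := pi_pos
  have hp0 : 0 ≤ p := by linarith
  have hlim : Tendsto (fun ε => ((2 * (∫ x in (0:ℝ)..(π/2), we p ε x))/π)^p *
      (∫ x in (0:ℝ)..(π/2), |cos x|^p * (we p ε x)^(1-p)) / (∫ x in (0:ℝ)..(π/2), |sin x|^p * we p ε x))
      (𝓝[>] 0) (𝓝 ((p-1) * nu p)) := by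
    have e : (p-1) * nu p = (2 * (p * KK p / (p-1)) / π)^p * KK p / (KK p / (p-1)) := by
      have : 2 * (p * KK p / (p-1)) / π = 2*p*KK p/((p-1)*π) := by field_simp
      rw [this, ← nu]
      field_simp
    rw [e]
    exact (((((W_tendsto p hp).const_mul 2).div_const π).rpow_const (Or.inr hp0)).mul (N_tendsto p hp)).div
      (S_tendsto p hp) (by positivity)
  have hev := hlim.eventually (gt_mem_nhds hδ)
  obtain ⟨ε, h1, hε⟩ := (hev.and self_mem_nhdsWithin).exists
  set W := ∫ x in (0:ℝ)..(π/2), we p ε x with hW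
  have hWpos : 0 < W := intervalIntegral.intervalIntegral_pos_of_pos_on ((we_cont hp hε).intervalIntegrable _ _)
    (fun x _ => we_pos hp hε x) (by positivity)
  set κ := π / (2 * W) with hκ
  have hκ0 : 0 < κ := by positivity
  obtain ⟨u, hu1, hu2, hu3, hu4, hu5⟩ := testA p (w := fun x => κ * we p ε x)
    (continuous_const.mul (we_cont hp hε)) (fun x => mul_pos hκ0 (we_pos hp hε x))
    (fun x => by simp only [we_per p ε x]) (by
      rw [intervalIntegral.integral_const_mul, quarter (we_cont hp hε) (we_ev p ε), ← hW, hκ]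
      field_simp)
  refine ⟨u, hu1, hu2, hu3, ?_⟩
  rw [hu4 hp0, hu5 hp0]
  have e1 : ∫ x in (0:ℝ)..(2*π), |sin x|^p * (κ * we p ε x) = κ * (4 * ∫ x in (0:ℝ)..(π/2), |sin x|^p * we p ε x) := by
    rw [← quarter2 (f := fun x => |sin x|^p * we p ε x)
      ((cont_rpow hp0 continuous_sin.abs).mul (we_cont hp hε))
      (fun x => by simp only [we_per p ε x, sin_add_pi, abs_neg])
      (fun x => by simp only [we_ev, sin_pi_sub]), ← intervalIntegral.integral_const_mul]
    congr 1; ext x; ring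
  have e2 : ∫ x in (0:ℝ)..(2*π), |cos x|^p * (κ * we p ε x)^(1-p) =
      κ^(1-p) * (4 * ∫ x in (0:ℝ)..(π/2), |cos x|^p * (we p ε x)^(1-p)) := by
    rw [← quarter2 (f := fun x => |cos x|^p * (we p ε x)^(1-p))
      ((cont_rpow hp0 continuous_cos.abs).mul ((we_cont hp hε).rpow_const (fun x => Or.inl (we_pos hp hε x).ne')))
      (fun x => by simp only [we_per p ε x, cos_add_pi, abs_neg])
      (fun x => by simp only [we_ev, cos_pi_sub, abs_neg]), ← intervalIntegral.integral_const_mul]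
    congr 1; ext x
    rw [Real.mul_rpow hκ0.le (we_pos hp hε x).le]; ring
  rw [e1, e2]
  refine lt_of_eq_of_lt ?_ h1
  have e3 : 2 * W / π = κ⁻¹ := by rw [hκ, inv_div]
  rw [e3, Real.inv_rpow hκ0.le, Real.rpow_sub hκ0, Real.rpow_one]
  have : 0 < κ^p := by positivity
  field_simp

lemma anti_int {f : ℝ → ℝ} (h : ∀ x, f (x+π) = - f x) : ∫ x in (0:ℝ)..(2*π), f x = 0 := by
  have hper : Function.Periodic f (2*π) := by
    intro x
    have : x + 2*π = (x+π)+π := by ring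
    rw [this, h, h, neg_neg]
  have h1 := per_int hper π
  have h2 : ∫ x in (0:ℝ)..(2*π), f (x+π) = ∫ y in π..(π+2*π), f y := by
    rw [intervalIntegral.integral_comp_add_right]
    congr 1 <;> ring
  simp only [h, intervalIntegral.integral_neg] at h2
  linarith

lemma phi_eq {p : ℝ} (hp : 1 < p) (t : ℝ) :
    |t|^(p-2) * t = (max t 0)^(p-1) - (max (-t) 0)^(p-1) := by
  have hp1 : p - 1 ≠ 0 := by linarith
  rcases lt_trichotomy t 0 with h | h | h
  · rw [max_eq_right h.le, max_eq_left (by linarith), abs_of_neg h, Real.zero_rpow hp1]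
    have : p - 1 = (p-2) + 1 := by ring
    rw [this, Real.rpow_add_one (by linarith)]; ring
  · subst h; simp
  · rw [max_eq_left h.le, max_eq_right (by linarith), abs_of_pos h, Real.zero_rpow hp1]
    have : p - 1 = (p-2) + 1 := by ring
    rw [this, Real.rpow_add_one (by linarith)]; ring

lemma phi_cont {p : ℝ} (hp : 1 < p) {u : ℝ → ℝ} (hu : Continuous u) :
    Continuous (fun x => |u x|^(p-2) * u x) := by
  simp only [phi_eq hp]
  exact (cont_rpow (by linarith) (hu.max continuous_const)).sub
    (cont_rpow (by linarith) (hu.neg.max continuous_const))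

lemma conv_pt {p : ℝ} (hp : 1 < p) (t c : ℝ) :
    |t|^p - p * c * (|t|^(p-2) * t) ≤ |t - c|^p := by
  have hy := young_aux hp (Real.rpow_nonneg (abs_nonneg t) p) (t - c)
  have hp0 : 0 < p := by linarith
  have e : (|t|^p)^(1-1/p) = |t|^(p-1) := by
    rw [← Real.rpow_mul (abs_nonneg t)]
    congr 1; field_simp
  rw [e] at hy
  have h2 : |t|^p - c * (|t|^(p-2) * t) ≤ |t|^(p-1) * |t - c| := by
    rcases eq_or_ne t 0 with h | h
    · subst h
      simp only [abs_zero, mul_zero, Real.zero_rpow hp0.ne']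
      simp only [sub_zero]
      positivity
    · have ht : 0 < |t| := abs_pos.2 h
      have e1 : |t|^(p-1) = |t|^(p-2) * |t| := by
        rw [← Real.rpow_add_one ht.ne']; ring_nf
      have e2 : |t|^p = |t|^(p-2) * (t * t) := by
        rw [← abs_mul_abs_self t, ← mul_assoc, ← Real.rpow_add_one ht.ne', ← Real.rpow_add_one ht.ne']; ring_nf
      rw [e1, e2, mul_assoc, ← abs_mul]
      have : |t|^(p-2) * (t*(t-c)) ≤ |t|^(p-2) * |t*(t-c)| := by
        gcongr; exact le_abs_self _
      linarith
  have := mul_le_mul_of_nonneg_left h2 hp0.le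
  linarith

lemma lower2 (p : ℝ) (hp : 1 < p) {u : ℝ → ℝ} (hper : Function.Periodic u (2*π)) (hu : ContDiff ℝ 1 u)
    (h0 : ∫ x in (0:ℝ)..(2*π), |u x|^(p-2) * u x = 0) :
    (p-1) * nu p * ∫ x in (0:ℝ)..(2*π), |u x|^p ≤ ∫ x in (0:ℝ)..(2*π), |deriv u x|^p := by
  have hp0 : 0 ≤ p := by linarith
  have hπ := pi_pos
  have hc := hu.continuous
  set c := (∫ x in (0:ℝ)..(2*π), u x) / (2*π) with hcdef
  have hl := lower p hp (v := fun x => u x - c) (fun x => by simp only [hper x])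
    (hu.sub contDiff_const) (by
      rw [intervalIntegral.integral_sub (hc.intervalIntegrable _ _) (continuous_const.intervalIntegrable _ _),
        intervalIntegral.integral_const, hcdef, smul_eq_mul]
      field_simp; ring)
  have hd : deriv (fun x => u x - c) = deriv u := by
    ext x; exact deriv_sub_const _
  rw [hd] at hl
  refine le_trans ?_ hl
  have : ∫ x in (0:ℝ)..(2*π), |u x|^p ≤ ∫ x in (0:ℝ)..(2*π), |u x - c|^p := by
    have i1 := (cont_rpow hp0 hc.abs).intervalIntegrable (μ := volume) 0 (2*π)
    have i2 := (continuous_const (y := p * c)).mul (phi_cont hp hc) |>.intervalIntegrable (μ := volume) 0 (2*π)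
    have i3 := (cont_rpow hp0 (hc.sub (continuous_const (y := c))).abs).intervalIntegrable (μ := volume) 0 (2*π)
    have := intervalIntegral.integral_mono_on two_pi_pos.le (i1.sub i2) i3 (fun x _ => conv_pt hp (u x) c)
    rw [intervalIntegral.integral_sub i1 i2] at this
    simp only [Pi.mul_apply, Pi.sub_apply] at this
    rw [intervalIntegral.integral_const_mul, h0] at this
    linarith
  have hn := nu_pos hp
  have : 0 < p - 1 := by linarith
  gcongr

lemma int_nonneg' (p : ℝ) (u : ℝ → ℝ) : 0 ≤ ∫ x in (0:ℝ)..(2*π), |u x|^p :=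
  intervalIntegral.integral_nonneg two_pi_pos.le (fun x _ => by positivity)

lemma ratio_p {p : ℝ} (hp : 1 < p) (a b : ℝ → ℝ) :
    (perNorm p a)^p / (perNorm p b)^p =
      (∫ x in (0:ℝ)..(2*π), |a x|^p) / (∫ x in (0:ℝ)..(2*π), |b x|^p) := by
  have ha := int_nonneg' p a
  have hb := int_nonneg' p b
  have hπ := pi_pos
  have hp0 : p ≠ 0 := by linarith
  unfold perNorm
  rw [← Real.rpow_mul (by positivity), ← Real.rpow_mul (by positivity), one_div_mul_cancel hp0,
    Real.rpow_one, Real.rpow_one, mul_div_mul_left _ _ (by positivity)]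

lemma ratio_2 {p : ℝ} (a b : ℝ → ℝ) :
    (perNorm p a)^2 / (perNorm p b)^2 =
      ((∫ x in (0:ℝ)..(2*π), |a x|^p) / (∫ x in (0:ℝ)..(2*π), |b x|^p))^(2/p) := by
  have ha := int_nonneg' p a
  have hb := int_nonneg' p b
  have hπ := pi_pos
  unfold perNorm
  rw [← Real.rpow_natCast, ← Real.rpow_natCast, ← Real.rpow_mul (by positivity), ← Real.rpow_mul (by positivity),
    ← Real.div_rpow (by positivity) (by positivity), mul_div_mul_left _ _ (by positivity)]
  congr 1
  push_cast; ring

lemma int_pos {p : ℝ} (hp : 1 < p) {u : ℝ → ℝ} (hu : PeriodicC1 u) (hne : u ≠ 0) :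
    0 < ∫ x in (0:ℝ)..(2*π), |u x|^p := by
  obtain ⟨x, hx⟩ := Function.ne_iff.1 hne
  apply ne_int_pos (f := fun x => |u x|^p) (fun x => by simp only [hu.1 x])
    (cont_rpow (by linarith) hu.2.continuous.abs) (fun x => by positivity)
  exact ⟨x, (Real.rpow_pos_of_pos (abs_pos.2 hx) p).ne'⟩

lemma anti_per {u : ℝ → ℝ} (h : ∀ x, u (x+π) = - u x) : Function.Periodic u (2*π) := by
  intro x
  have : x + 2*π = (x+π)+π := by ring
  rw [this, h, h, neg_neg]

lemma Lam_eq (p : ℝ) (hp : 1 < p) :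
    sInf { l : ℝ | ∃ u : ℝ → ℝ, PeriodicC1 u ∧ u ≠ 0 ∧
      (∫ x in (0:ℝ)..(2 * π), |u x| ^ (p - 2) * u x) = 0 ∧
      l = (perNorm p (deriv u)) ^ p / (perNorm p u) ^ p } = (p-1) * nu p := by
  have mem : ∀ δ, (p-1) * nu p < δ → ∃ l ∈ { l : ℝ | ∃ u : ℝ → ℝ, PeriodicC1 u ∧ u ≠ 0 ∧
      (∫ x in (0:ℝ)..(2 * π), |u x| ^ (p - 2) * u x) = 0 ∧
      l = (perNorm p (deriv u)) ^ p / (perNorm p u) ^ p }, l < δ := by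
    intro δ hδ
    obtain ⟨u, h1, h2, h3, h4⟩ := test_exists p hp hδ
    refine ⟨_, ⟨u, ⟨anti_per h2, h1⟩, h3, ?_, rfl⟩, ?_⟩
    · apply anti_int (f := fun x => |u x| ^ (p - 2) * u x)
      intro x
      simp only [h2, abs_neg]; ring
    · rwa [ratio_p hp]
  apply csInf_eq_of_forall_ge_of_forall_gt_exists_lt
  · obtain ⟨l, hl, _⟩ := mem _ (lt_add_one _)
    exact ⟨l, hl⟩
  · rintro l ⟨u, hu, hne, h0, rfl⟩
    rw [ratio_p hp, le_div_iff₀ (int_pos hp hu hne)]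
    exact lower2 p hp hu.1 hu.2 h0
  · exact mem

lemma lam_eq (p : ℝ) (hp : 1 < p) : lambdaOne p = ((p-1) * nu p)^(2/p) := by
  have hn := nu_pos hp
  have hp1 : 0 < p - 1 := by linarith
  have hp0 : 0 < p := by linarith
  have mem : ∀ w, ((p-1) * nu p)^(2/p) < w → ∃ l ∈ { l : ℝ | ∃ v : ℝ → ℝ, PeriodicC1 v ∧ v ≠ 0 ∧
    (∫ x in (0:ℝ)..(2 * π), v x) = 0 ∧
    l = (perNorm p (deriv v)) ^ 2 / (perNorm p v) ^ 2 }, l < w := by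
    intro w hw
    have hw0 : 0 < w := lt_of_le_of_lt (by positivity) hw
    have hδ : (p-1) * nu p < w^(p/2) := by
      have := Real.rpow_lt_rpow (z := p/2) (by positivity) hw (by positivity)
      rw [← Real.rpow_mul (by positivity)] at this
      have e : 2/p*(p/2) = 1 := by field_simp
      rwa [e, Real.rpow_one] at this
    obtain ⟨u, h1, h2, h3, h4⟩ := test_exists p hp hδ
    refine ⟨_, ⟨u, ⟨anti_per h2, h1⟩, h3, anti_int h2, rfl⟩, ?_⟩
    rw [ratio_2]
    have := Real.rpow_lt_rpow (z := 2/p) (div_nonneg (int_nonneg' _ _) (int_nonneg' _ _)) h4 (by positivity)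
    rw [← Real.rpow_mul hw0.le] at this
    have e : p/2*(2/p) = 1 := by field_simp
    rwa [e, Real.rpow_one] at this
  unfold lambdaOne
  apply csInf_eq_of_forall_ge_of_forall_gt_exists_lt
  · obtain ⟨l, hl, _⟩ := mem _ (lt_add_one _)
    exact ⟨l, hl⟩
  · rintro l ⟨u, hu, hne, h0, rfl⟩
    rw [ratio_2]
    apply Real.rpow_le_rpow (by positivity) _ (by positivity)
    rw [le_div_iff₀ (int_pos hp hu hne)]
    exact lower p hp hu.1 hu.2 h0
  · exact mem

/-- λ₁ = Λ₁^{2/p}, relating the two optimal Poincaré constants. -/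
theorem lambdaOne_eq_LambdaOne_rpow (p : ℝ) (hp : 1 < p)
    (Lam1 : ℝ)
    (hLam1 : Lam1 = sInf { l : ℝ | ∃ u : ℝ → ℝ, PeriodicC1 u ∧ u ≠ 0 ∧
      (∫ x in (0:ℝ)..(2 * π), |u x| ^ (p - 2) * u x) = 0 ∧
      l = (perNorm p (deriv u)) ^ p / (perNorm p u) ^ p }) :
    lambdaOne p = Lam1 ^ (2 / p) := by

  rw [hLam1, Lam_eq p hp, lam_eq p hp]
end
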